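/- arXiv:0904.3555 — 3 statements merged into one kernel-verified Lean document; each statement's English description precedes it below -/
import Mathlib

section
/- Let a, b, c, d ∈ ℤ and f(z) = z⁵ + a·z³ + b·z² + c·z + d. Suppose the set {(X,Y) ∈ ℚ² : Y² = X³ + 135(2a − 15)·X − 1350(5a + 2b − 26)} is infinite. Then for every polynomial g ∈ ℚ[x,y,z] such that g(x₀,y₀,z₀) = 0 for all (x₀,y₀,z₀) ∈ ℚ³ with x₀² − y₀³ − f(z₀) = 0, the polynomial x² − y³ − f(z) divides g in ℚ[x,y,z]. -/
open MvPolynomial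

open Polynomial in
/-- Over a domain, a polynomial of degree three is not a square in the fraction field. -/
theorem eq_zero_of_sq_eq_cubic_mul_sq {R : Type*} [CommRing R] [IsDomain R] {h A B : R[X]}
    (hh : h.natDegree = 3) (hAB : A ^ 2 = h * B ^ 2) : A = 0 ∧ B = 0 := by
  have hh0 : h ≠ 0 := by rintro rfl; simp at hh
  by_cases hB : B = 0
  · subst hB; simpa using hAB
  · have := congrArg natDegree hAB
    rw [natDegree_pow, natDegree_mul hh0 (pow_ne_zero 2 hB), natDegree_pow] at this
    omega

/-- Division with remainder by `X i ^ 2 - φ h`, where `φ` embeds the polynomials in the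
variables other than `X i`. -/
theorem exists_reduction_mod_sq_sub {σ R : Type*} [CommRing R] (φ : R →+* MvPolynomial σ ℚ)
    (i : σ) (h : R) (hC : ∀ q : ℚ, ∃ r, φ r = C q) (hX : ∀ j ≠ i, ∃ r, φ r = X j)
    (g : MvPolynomial σ ℚ) :
    ∃ A B Q, g = φ A + X i * φ B + (X i ^ 2 - φ h) * Q := by
  induction g using MvPolynomial.induction_on with
  | C q =>
    obtain ⟨r, hr⟩ := hC q
    exact ⟨r, 0, 0, by simp [hr]⟩
  | add p q hp hq =>
    obtain ⟨A, B, Q, h₁⟩ := hp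
    obtain ⟨A', B', Q', h₂⟩ := hq
    exact ⟨A + A', B + B', Q + Q', by rw [h₁, h₂, map_add, map_add]; ring⟩
  | mul_X p j hp =>
    obtain ⟨A, B, Q, h₁⟩ := hp
    by_cases hj : j = i
    · subst hj
      exact ⟨h * B, A, φ B + X j * Q, by rw [h₁, map_mul]; ring⟩
    · obtain ⟨r, hr⟩ := hX j hj
      exact ⟨A * r, B * r, Q * X j, by rw [h₁, map_mul, map_mul, hr]; ring⟩

/-- A polynomial function which does not vanish at some real point of the curve `E² = h(m)`,
`deg h = 3`, vanishes at only finitely many rational points of it. -/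
theorem finite_zeros_on_cubic (h : Polynomial ℚ) (hh : h.natDegree = 3)
    (P : MvPolynomial (Fin 2) ℚ) {m E : ℝ} (hE : E ^ 2 = Polynomial.aeval m h)
    (hP : aeval ![m, E] P ≠ 0) :
    {p : ℚ × ℚ | p.2 ^ 2 = h.eval p.1 ∧ eval ![p.1, p.2] P = 0}.Finite := by
  set S := {p : ℚ × ℚ | p.2 ^ 2 = h.eval p.1 ∧ eval ![p.1, p.2] P = 0}
  by_contra hS
  obtain ⟨A, B, Q, hABQ⟩ := exists_reduction_mod_sq_sub
    (Polynomial.aeval (X 0 : MvPolynomial (Fin 2) ℚ)).toRingHom 1 h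
    (fun q => ⟨Polynomial.C q, by simp⟩)
    (fun j hj => ⟨Polynomial.X, by
      have : j = 0 := by omega
      simp [this]⟩) P
  have hS' : (Prod.fst '' S).Infinite := by
    intro hfin
    refine hS (Set.Finite.of_finite_fibers Prod.fst hfin fun x _ => ?_)
    refine ((Polynomial.finite_setOfPred_isRoot (p := Polynomial.X ^ 2 - Polynomial.C (h.eval x))
      (Polynomial.X_pow_sub_C_ne_zero (by norm_num) _)).image (fun y => (x, y))).subset ?_
    rintro ⟨x', y⟩ ⟨⟨hy, -⟩, rfl : x' = x⟩
    exact ⟨y, by simpa [sub_eq_zero] using hy, rfl⟩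
  have hnorm : A ^ 2 - h * B ^ 2 = 0 := by
    refine Polynomial.eq_zero_of_infinite_isRoot _ (hS'.mono ?_)
    rintro _ ⟨⟨x, y⟩, ⟨hy, h0⟩, rfl⟩
    have e₁ (q : Polynomial ℚ) : eval ![x, y] (Polynomial.aeval (X 0) q) = q.eval x := by
      rw [← MvPolynomial.coe_aeval_eq_eval, RingHom.coe_coe, ← Polynomial.aeval_algHom_apply]
      simp [Polynomial.aeval_def, Polynomial.eval₂_eq_eval_map]
    rw [hABQ] at h0
    simp [e₁] at h0 hy
    rw [hy] at h0
    have h1 : A.eval x ^ 2 - h.eval x * B.eval x ^ 2 = 0 := by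
      linear_combination (A.eval x - y * B.eval x) * h0 + (B.eval x) ^ 2 * hy
    simpa [Polynomial.IsRoot] using h1
  obtain ⟨rfl, rfl⟩ := eq_zero_of_sq_eq_cubic_mul_sq hh (sub_eq_zero.mp hnorm)
  apply hP
  rw [hABQ]
  have e₁ : aeval ![m, E] (Polynomial.aeval (X 0 : MvPolynomial (Fin 2) ℚ) h)
      = Polynomial.aeval m h := by
    rw [← Polynomial.aeval_algHom_apply]; simp
  simp [e₁, hE]

open Polynomial in
theorem eq_zero_of_infinite_evalEval (P : ℚ[X][X]) {Z : Set ℚ} (hZ : Z.Infinite)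
    (hP : ∀ z ∈ Z, {y | P.evalEval z y = 0}.Infinite) : P = 0 := by
  ext1 n
  refine Polynomial.eq_zero_of_infinite_isRoot _ (hZ.mono fun z hz => ?_)
  have : P.map (evalRingHom z) = 0 := by
    refine Polynomial.eq_zero_of_infinite_isRoot _ ((hP z hz).mono fun y hy => ?_)
    simpa only [Set.mem_ofPred_eq, IsRoot, map_evalRingHom_eval] using hy
  simpa [Polynomial.coeff_map] using congrArg (Polynomial.coeff · n) this

/-- If infinitely many fibres of `x² = y³ + f(z)` contain infinitely many rational points, then
the rational points are Zariski dense. -/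
theorem dvd_of_infinite_fibres (f : Polynomial ℚ) {Z : Set ℚ} (hZ : Z.Infinite)
    (hfib : ∀ z ∈ Z, {y : ℚ | ∃ x, x ^ 2 = y ^ 3 + f.eval z}.Infinite)
    (g : MvPolynomial (Fin 3) ℚ)
    (hg : ∀ x y z : ℚ, x ^ 2 = y ^ 3 + f.eval z → eval ![x, y, z] g = 0) :
    (X 0 ^ 2 - (X 1 ^ 3 + Polynomial.aeval (X 2) f) : MvPolynomial (Fin 3) ℚ) ∣ g := by
  set φ : Polynomial (Polynomial ℚ) →+* MvPolynomial (Fin 3) ℚ :=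
    Polynomial.eval₂RingHom (Polynomial.aeval (X 2 : MvPolynomial (Fin 3) ℚ)).toRingHom (X 1)
  set h : Polynomial (Polynomial ℚ) := Polynomial.X ^ 3 + Polynomial.C f with hdef
  have hφ : φ h = X 1 ^ 3 + Polynomial.aeval (X 2) f := by simp [φ, h]
  obtain ⟨A, B, Q, hABQ⟩ := exists_reduction_mod_sq_sub φ 0 h
    (fun q => ⟨Polynomial.C (Polynomial.C q), by simp [φ]⟩)
    (fun j hj => by
      obtain rfl | rfl : j = 1 ∨ j = 2 := by omega
      · exact ⟨Polynomial.X, by simp [φ]⟩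
      · exact ⟨Polynomial.C Polynomial.X, by simp [φ]⟩) g
  have heval (x y z : ℚ) (q : Polynomial (Polynomial ℚ)) :
      eval ![x, y, z] (φ q) = q.evalEval z y := by
    have : (eval ![x, y, z]).comp φ = Polynomial.evalEvalRingHom z y := by
      ext <;> simp [φ]
    exact congrArg (fun ψ : _ →+* ℚ => ψ q) this
  have hnorm : A ^ 2 - h * B ^ 2 = 0 := by
    refine eq_zero_of_infinite_evalEval _ hZ fun z hz => (hfib z hz).mono ?_
    rintro y ⟨x, hx⟩
    have h0 := hg x y z hx
    rw [hABQ] at h0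
    have hh : h.evalEval z y = y ^ 3 + f.eval z := by simp [h, Polynomial.evalEval]
    simp only [map_add, map_mul, map_sub, map_pow, heval, hh, eval_X] at h0
    simp only [Matrix.cons_val_zero, hx] at h0
    simp only [Set.mem_ofPred_eq, Polynomial.evalEval_sub, Polynomial.evalEval_mul,
      Polynomial.evalEval_pow, hh]
    linear_combination (A.evalEval z y - x * B.evalEval z y) * h0 + (B.evalEval z y) ^ 2 * hx
  obtain ⟨rfl, rfl⟩ := eq_zero_of_sq_eq_cubic_mul_sq
    (by simp [hdef]) (sub_eq_zero.mp hnorm)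
  exact ⟨Q, by rw [hABQ, hφ]; simp⟩

/-- In the coordinates `m = X 0`, `E = X 1`, the coefficient `e` of the family
`y = U² + e`, `x = U³ + U² / 2 + β U + γ` with `U = z + m`. On the curve `E² = paramCubic(m)`,
`x² - y³ - f(z)` is the linear polynomial `uDen * U - uNum` in `U`. -/
noncomputable def eCoeff : MvPolynomial (Fin 2) ℚ := X 1 - 5 * X 0 - C (3 / 4)

/-- The coefficient `β` of the family, see `eCoeff`. -/
noncomputable def betaCoeff : MvPolynomial (Fin 2) ℚ := C (3 / 2) * X 1 - 10 * X 0 - C (5 / 4)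

/-- The coefficient `γ` of the family, see `eCoeff`. -/
noncomputable def gammaCoeff (a : ℚ) : MvPolynomial (Fin 2) ℚ :=
  5 * X 0 ^ 2 + C (a / 2) - C (1 / 2) * betaCoeff

/-- The denominator of the coordinate `U`, see `eCoeff`. -/
noncomputable def uDen (a b c : ℚ) : MvPolynomial (Fin 2) ℚ :=
  2 * betaCoeff * gammaCoeff a
    - (5 * X 0 ^ 4 + C (3 * a) * X 0 ^ 2 - C (2 * b) * X 0 + C c)

/-- The numerator of the coordinate `U`, see `eCoeff`. -/
noncomputable def uNum (a b c d : ℚ) : MvPolynomial (Fin 2) ℚ :=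
  eCoeff ^ 3 - gammaCoeff a ^ 2
    + (-X 0 ^ 5 - C a * X 0 ^ 3 + C b * X 0 ^ 2 - C c * X 0 + C d)

/-- The numerator of `z = U - m`, with denominator `uDen`. -/
noncomputable def zNum (a b c d : ℚ) : MvPolynomial (Fin 2) ℚ :=
  uNum a b c d - X 0 * uDen a b c

/-- The numerator of `y = U² + e`, with denominator `uDen ^ 2`. -/
noncomputable def yNum (a b c d : ℚ) : MvPolynomial (Fin 2) ℚ :=
  uNum a b c d ^ 2 + eCoeff * uDen a b c ^ 2

/-- The numerator of `f(z)`, with denominator `uDen ^ 5`. -/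
noncomputable def fNum (a b c d : ℚ) : MvPolynomial (Fin 2) ℚ :=
  zNum a b c d ^ 5 + C a * zNum a b c d ^ 3 * uDen a b c ^ 2
    + C b * zNum a b c d ^ 2 * uDen a b c ^ 3 + C c * zNum a b c d * uDen a b c ^ 4
    + C d * uDen a b c ^ 5

/-- The cubic `h` for which the curve `E² = h(m)` parametrises the family. -/
noncomputable def paramCubic (a b : ℚ) : Polynomial ℚ :=
  Polynomial.C (40 / 3) * Polynomial.X ^ 3 + Polynomial.C 40 * Polynomial.X ^ 2
    + Polynomial.C (10 + 4 * a) * Polynomial.X + Polynomial.C ((2 + 2 * a - 4 * b) / 3)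

theorem natDegree_paramCubic (a b : ℚ) : (paramCubic a b).natDegree = 3 :=
  Polynomial.natDegree_cubic (by norm_num)

open Filter Topology in
/-- Substituting `m = 1 / u`, `E = v / u²` with `u → 0⁺`: a polynomial with nonzero leading term at
infinity does not vanish identically on the curve `E² = paramCubic(m)`. -/
theorem exists_real_point_ne_zero (a b c d : ℚ) (P : MvPolynomial (Fin 2) ℚ)
    (n : ℕ) (F : ℝ → ℝ → ℝ → ℝ → ℝ)
    (hF : Continuous fun p : ℝ × ℝ × ℝ × ℝ => F p.1 p.2.1 p.2.2.1 p.2.2.2)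
    (hF0 : F 0 0 (-5) 4 ≠ 0)
    (hP : ∀ u v D K : ℝ, u ≠ 0 →
      aeval ![u⁻¹, v / u ^ 2] (uDen a b c) = D / u ^ 4 →
      aeval ![u⁻¹, v / u ^ 2] (zNum a b c d) = K / u ^ 5 →
      aeval ![u⁻¹, v / u ^ 2] P = F u v D K / u ^ n) :
    ∃ m E : ℝ, E ^ 2 = Polynomial.aeval m (paramCubic a b) ∧ aeval ![m, E] P ≠ 0 := by
  set G : ℝ → ℝ := fun u => 40 / 3 + 40 * u + (10 + 4 * a) * u ^ 2 + (2 + 2 * a - 4 * b) / 3 * u ^ 3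
    with hG
  set v : ℝ → ℝ := fun u => √(u * G u) with hv
  set β : ℝ → ℝ := fun u => 3 / 2 * v u - 10 * u - 5 / 4 * u ^ 2 with hβ
  set γ : ℝ → ℝ := fun u => 5 + a / 2 * u ^ 2 - β u / 2 with hγ
  set D : ℝ → ℝ := fun u => 2 * β u * γ u - (5 + 3 * a * u ^ 2 - 2 * b * u ^ 3 + c * u ^ 4) with hD
  set K : ℝ → ℝ := fun u =>
    (v u - 5 * u - 3 / 4 * u ^ 2) * (G u - 2 * v u * (5 + 3 / 4 * u) + u * (5 + 3 / 4 * u) ^ 2)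
      - u * γ u ^ 2 + (-1 - a * u ^ 2 + b * u ^ 3 - c * u ^ 4 + d * u ^ 5) - D u with hK
  have hGc : Continuous G := by fun_prop
  have hcont : Continuous fun u => F u (v u) (D u) (K u) :=
    hF.comp (by fun_prop : Continuous fun u => (u, v u, D u, K u))
  have h1 : ∀ᶠ u in 𝓝[>] (0 : ℝ), F u (v u) (D u) (K u) ≠ 0 := by
    refine (hcont.continuousAt.eventually_ne ?_).filter_mono nhdsWithin_le_nhds
    convert hF0 using 2 <;> norm_num [hK, hD, hγ, hβ, hv, hG]
  have h2 : ∀ᶠ u in 𝓝[>] (0 : ℝ), 0 < G u :=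
    (hGc.continuousAt.eventually (lt_mem_nhds (by norm_num [hG]))).filter_mono nhdsWithin_le_nhds
  obtain ⟨u, hu1, hu2, hu : 0 < u⟩ := (h1.and (h2.and self_mem_nhdsWithin)).exists
  have hv2 : v u ^ 2 = u * G u := Real.sq_sqrt (by positivity)
  have hu0 := hu.ne'
  have hDen : aeval ![u⁻¹, v u / u ^ 2] (uDen a b c) = D u / u ^ 4 := by
    simp [uDen, betaCoeff, gammaCoeff, hD, hγ, hβ]
    field_simp
  refine ⟨u⁻¹, v u / u ^ 2, ?_, ?_⟩
  · rw [div_pow, hv2]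
    simp [paramCubic, hG]
    field_simp
  · rw [hP u (v u) (D u) (K u) hu0 hDen]
    · positivity
    · have hE : aeval ![u⁻¹, v u / u ^ 2] eCoeff = (v u - 5 * u - 3 / 4 * u ^ 2) / u ^ 2 := by
        simp [eCoeff]
        field_simp
      have hg : aeval ![u⁻¹, v u / u ^ 2] (gammaCoeff a) = γ u / u ^ 2 := by
        simp [betaCoeff, gammaCoeff, hγ, hβ]
        field_simp
      have he3 : ((v u - 5 * u - 3 / 4 * u ^ 2) / u ^ 2) ^ 3 =
          (v u - 5 * u - 3 / 4 * u ^ 2) *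
            (G u - 2 * v u * (5 + 3 / 4 * u) + u * (5 + 3 / 4 * u) ^ 2) / u ^ 5 := by
        rw [div_pow, div_eq_div_iff (by positivity) (by positivity)]
        linear_combination (v u - 5 * u - 3 / 4 * u ^ 2) * u ^ 5 * hv2
      simp only [zNum, uNum, map_add, map_sub, map_mul, map_pow, map_neg, hDen, hE, hg, he3, hK]
      simp
      field_simp

theorem exists_real_point_zNum (a b c d τ : ℚ) :
    ∃ m E : ℝ, E ^ 2 = Polynomial.aeval m (paramCubic a b) ∧
      aeval ![m, E] (zNum a b c d - C τ * uDen a b c) ≠ 0 := by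
  refine exists_real_point_ne_zero a b c d _ 5 (fun u v D K => K - τ * u * D) (by fun_prop)
    (by norm_num) fun u v D K hu hD hK => ?_
  simp only [map_sub, map_mul, hD, hK]
  simp
  field_simp

/-- Nonzero at the points of the parametrising curve for which the point of the surface is defined
and is not torsion in its fibre. -/
noncomputable def degeneracy (a b c d : ℚ) : MvPolynomial (Fin 2) ℚ :=
  uDen a b c * fNum a b c d * yNum a b c d *
    (yNum a b c d ^ 3 + uDen a b c * fNum a b c d) *
    (yNum a b c d ^ 3 + 4 * uDen a b c * fNum a b c d) *
    (yNum a b c d ^ 3 - 8 * uDen a b c * fNum a b c d)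

theorem exists_real_point_degeneracy (a b c d : ℚ) :
    ∃ m E : ℝ, E ^ 2 = Polynomial.aeval m (paramCubic a b) ∧
      aeval ![m, E] (degeneracy a b c d) ≠ 0 := by
  set Y : ℝ → ℝ → ℝ → ℝ → ℝ := fun u v D K =>
    (K + D) ^ 2 + (v - 5 * u - 3 / 4 * u ^ 2) * D ^ 2 with hY
  set F : ℝ → ℝ → ℝ → ℝ → ℝ := fun u v D K =>
    K ^ 5 + a * K ^ 3 * D ^ 2 * u ^ 2 + b * K ^ 2 * D ^ 3 * u ^ 3 + c * K * D ^ 4 * u ^ 4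
      + d * D ^ 5 * u ^ 5 with hF
  refine exists_real_point_ne_zero a b c d _ 129 (fun u v D K => D * F u v D K * Y u v D K *
    (Y u v D K ^ 3 + u * (D * F u v D K)) * (Y u v D K ^ 3 + u * (4 * D * F u v D K)) *
    (Y u v D K ^ 3 - u * (8 * D * F u v D K))) (by fun_prop)
    (by norm_num [hY, hF]) fun u v D K hu hD hK => ?_
  have hN : aeval ![u⁻¹, v / u ^ 2] (uNum a b c d) = (K + D) / u ^ 5 := by
    have : uNum a b c d = zNum a b c d + X 0 * uDen a b c := by rw [zNum]; ring
    rw [this, map_add, map_mul, hD, hK]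
    simp
    field_simp
  have hy : aeval ![u⁻¹, v / u ^ 2] (yNum a b c d) = Y u v D K / u ^ 10 := by
    simp only [yNum, map_add, map_mul, map_pow, hN, hD]
    simp [eCoeff, hY]
    field_simp
  have hf : aeval ![u⁻¹, v / u ^ 2] (fNum a b c d) = F u v D K / u ^ 25 := by
    simp only [fNum, map_add, map_mul, map_pow, hK, hD]
    simp [hF]
    field_simp
  simp only [degeneracy, map_add, map_mul, map_sub, map_pow, hD, hf, hy, map_ofNat]
  field_simp

theorem padicValRat_add_of_lt {p : ℕ} [Fact p.Prime] {x y : ℚ} (hx : x ≠ 0)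
    (hxy : y ≠ 0 → padicValRat p x < padicValRat p y) :
    x + y ≠ 0 ∧ padicValRat p (x + y) = padicValRat p x := by
  by_cases hy : y = 0
  · simp [hy, hx]
  · have h : x + y ≠ 0 := fun h => by
      have := hxy hy
      rw [eq_neg_of_add_eq_zero_right h, padicValRat.neg] at this
      exact this.false
    exact ⟨h, padicValRat.add_eq_of_lt h hx hy (hxy hy)⟩

theorem one_le_padicValRat_two_add_one {u : ℚ} (hu : u ≠ 0) (hv : padicValRat 2 u = 0)
    (hu1 : u + 1 ≠ 0) : 1 ≤ padicValRat 2 (u + 1) := by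
  have hd0 : (u.den : ℚ) ≠ 0 := by exact_mod_cast u.den_ne_zero
  have hcop := u.reduced
  rw [padicValRat_def] at hv
  have hden : ¬ 2 ∣ u.den := fun h => by
    have h1 : ¬ 2 ∣ u.num.natAbs := fun h' => by
      have := Nat.dvd_gcd h' h
      rw [hcop.gcd_eq_one] at this
      omega
    have h2 : padicValInt 2 u.num = 0 := padicValNat.eq_zero_of_not_dvd h1
    have h3 := one_le_padicValNat_of_dvd u.den_ne_zero h
    omega
  have hden0 : padicValNat 2 u.den = 0 := padicValNat.eq_zero_of_not_dvd hden
  have hnum : ¬ (2 : ℤ) ∣ u.num := by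
    have h2 : padicValInt 2 u.num = 0 := by omega
    rcases padicValInt.eq_zero_iff.mp h2 with h | h | h
    · omega
    · exact absurd (Rat.num_eq_zero.mp h) hu
    · exact_mod_cast h
  have hsum : u + 1 = ((u.num + u.den : ℤ) : ℚ) / ((u.den : ℤ) : ℚ) := by
    push_cast
    rw [add_div, div_self hd0, Rat.num_div_den]
  have hne : (u.num + u.den : ℤ) ≠ 0 := fun h => hu1 (by rw [hsum, h]; simp)
  rw [hsum, padicValRat.div (by exact_mod_cast hne) (by exact_mod_cast hd0), padicValRat.of_int,
    Int.cast_natCast, padicValRat.of_nat, hden0]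
  have : 1 ≤ padicValNat 2 (u.num + u.den : ℤ).natAbs :=
    one_le_padicValNat_of_dvd (by omega) (by omega)
  unfold padicValInt
  omega

theorem padicValRat_two_four : padicValRat 2 4 = 2 := by
  rw [show (4 : ℚ) = (2 : ℕ) ^ 2 by norm_num, padicValRat.pow, padicValRat.self (by norm_num)]; rfl

theorem padicValRat_two_eight : padicValRat 2 (-8) = 3 := by
  rw [padicValRat.neg, show (8 : ℚ) = (2 : ℕ) ^ 3 by norm_num, padicValRat.pow,
    padicValRat.self (by norm_num)]; rfl

theorem padicValRat_two_sixty_four : padicValRat 2 64 = 6 := by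
  rw [show (64 : ℚ) = (2 : ℕ) ^ 6 by norm_num, padicValRat.pow, padicValRat.self (by norm_num)]; rfl

theorem padicValRat_two_fifty_four : padicValRat 2 54 = 1 := by
  have : padicValNat 2 27 = 0 := padicValNat.eq_zero_of_not_dvd (by norm_num)
  rw [show (54 : ℚ) = (2 : ℕ) * (27 : ℕ) by norm_num,
    padicValRat.mul (by norm_num) (by norm_num), padicValRat.self (by norm_num),
    padicValRat.of_nat, this]; rfl

/-- The effect of point doubling on the invariant `y³ / k` of a point of `x² = y³ + k`. -/
def doubleInvariant (w : ℚ) : ℚ := w * (w - 8) ^ 3 / (64 * (w + 1) ^ 3)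

theorem padicValRat_doubleInvariant {w : ℚ} (h0 : w ≠ 0) (h1 : w + 1 ≠ 0) (h8 : w + -8 ≠ 0) :
    padicValRat 2 (doubleInvariant w) =
      padicValRat 2 w + 3 * padicValRat 2 (w + -8) - 6 - 3 * padicValRat 2 (w + 1) := by
  rw [doubleInvariant, sub_eq_add_neg, padicValRat.div (mul_ne_zero h0 (pow_ne_zero 3 h8))
      (mul_ne_zero (by norm_num) (pow_ne_zero 3 h1)),
    padicValRat.mul h0 (pow_ne_zero 3 h8), padicValRat.mul (by norm_num) (pow_ne_zero 3 h1),
    padicValRat.pow, padicValRat.pow, padicValRat_two_sixty_four]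
  push_cast
  ring

/-- Doubling brings a point 2-adically closer to a point of order three. -/
theorem padicValRat_doubleInvariant_add_four {w : ℚ} (hw : padicValRat 2 w = 2) (h0 : w ≠ 0)
    (h4 : w + 4 ≠ 0) : doubleInvariant w + 4 ≠ 0 ∧
      padicValRat 2 (doubleInvariant w + 4) = padicValRat 2 (w + 4) + 1 := by
  obtain ⟨r, hr⟩ : ∃ r, w = 4 * (r - 1) := ⟨w / 4 + 1, by ring⟩
  have hr0 : r ≠ 0 := by rintro rfl; exact h4 (by rw [hr]; ring)
  have hu0 : r - 1 ≠ 0 := by intro h; exact h0 (by rw [hr, h]; ring)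
  have hvu : padicValRat 2 (r - 1) = 0 := by
    rw [hr, padicValRat.mul (by norm_num) hu0, padicValRat_two_four] at hw
    omega
  have hvr : 1 ≤ padicValRat 2 r := by
    simpa using one_le_padicValRat_two_add_one hu0 hvu (by simpa using hr0)
  obtain ⟨h1, hv1⟩ : w + 1 ≠ 0 ∧ padicValRat 2 (w + 1) = 0 := by
    have := padicValRat_add_of_lt (p := 2) (x := 1) (y := w) one_ne_zero
      (fun _ => by rw [hw, padicValRat.one]; norm_num)
    rwa [add_comm, padicValRat.one] at this
  have hv54 := padicValRat_two_fifty_four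
  have hvr2 : padicValRat 2 (54 * r ^ 2) = 1 + 2 * padicValRat 2 r := by
    rw [padicValRat.mul (by norm_num) (by positivity), padicValRat.pow, hv54]; rfl
  have hvr1 : padicValRat 2 (-54 * (4 * r) / 2) = 2 + padicValRat 2 r := by
    have : padicValRat 2 2 = 1 := padicValRat.self (p := 2) (by norm_num)
    rw [padicValRat.div (by simpa using hr0) (by norm_num),
      padicValRat.mul (by norm_num) (by simpa using hr0), padicValRat.neg, hv54,
      padicValRat.mul (by norm_num) hr0, padicValRat_two_four, this]
    ring
  obtain ⟨ha, hva⟩ := padicValRat_add_of_lt (p := 2) (x := 54) (y := -54 * (4 * r) / 2)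
    (by norm_num) (fun _ => by omega)
  obtain ⟨hb, hvb⟩ := padicValRat_add_of_lt (p := 2) ha (y := 54 * r ^ 2) (fun _ => by omega)
  obtain ⟨hc, hvc⟩ := padicValRat_add_of_lt (p := 2) hb (y := r ^ 3)
    (fun _ => by rw [padicValRat.pow]; push_cast; omega)
  set q := 54 + -54 * (4 * r) / 2 + 54 * r ^ 2 + r ^ 3 with hq
  have key : doubleInvariant w + 4 = (w + 4) * q / (w + 1) ^ 3 := by
    rw [doubleInvariant, eq_div_iff (pow_ne_zero 3 h1)]
    field_simp
    rw [hq, hr]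
    ring
  refine ⟨key ▸ div_ne_zero (mul_ne_zero h4 hc) (pow_ne_zero 3 h1), ?_⟩
  rw [key, padicValRat.div (mul_ne_zero h4 hc) (pow_ne_zero 3 h1), padicValRat.mul h4 hc,
    padicValRat.pow, hv1]
  omega

/-- A finite set of rationals stable under doubling only contains invariants of torsion points. -/
theorem mem_torsion_of_finite_of_stable {V : Set ℚ} (hV : V.Finite)
    (hstable : ∀ w ∈ V, w + 1 ≠ 0 → doubleInvariant w ∈ V) {w : ℚ} (hw : w ∈ V) :
    w = 0 ∨ w = -1 ∨ w = -4 ∨ w = 8 := by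
  have hv8 := padicValRat_two_eight
  have hv1 : padicValRat 2 1 = 0 := padicValRat.one
  have val_neg (w : ℚ) (hw : padicValRat 2 w < 0) :
      w ≠ 0 ∧ (w + 1 ≠ 0 ∧ padicValRat 2 (w + 1) = padicValRat 2 w) ∧
        (w + -8 ≠ 0 ∧ padicValRat 2 (w + -8) = padicValRat 2 w) := by
    have h0 : w ≠ 0 := by rintro rfl; simp at hw
    exact ⟨h0, padicValRat_add_of_lt h0 fun _ => by omega,
      padicValRat_add_of_lt h0 fun _ => by omega⟩
  have val_pos (w : ℚ) (hw : 0 < padicValRat 2 w) :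
      w ≠ 0 ∧ (w + 1 ≠ 0 ∧ padicValRat 2 (w + 1) = 0) := by
    have h0 : w ≠ 0 := by rintro rfl; simp at hw
    have := padicValRat_add_of_lt (p := 2) (x := 1) (y := w) one_ne_zero fun _ => by omega
    rw [add_comm, hv1] at this
    exact ⟨h0, this⟩
  have val_lt (w : ℚ) (hw : padicValRat 2 w < 3) (h0 : w ≠ 0) :
      w + -8 ≠ 0 ∧ padicValRat 2 (w + -8) = padicValRat 2 w :=
    padicValRat_add_of_lt h0 fun _ => by omega
  have hA : ∀ w ∈ V, 0 ≤ padicValRat 2 w := by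
    intro w hw
    by_contra! hneg
    obtain ⟨m, hm, hmin⟩ := V.exists_min_image (padicValRat 2) hV ⟨w, hw⟩
    obtain ⟨h0, ⟨h1, hv1⟩, h8, hv8⟩ := val_neg m ((hmin w hw).trans_lt hneg)
    have := hmin _ (hstable m hm h1)
    rw [padicValRat_doubleInvariant h0 h1 h8] at this
    omega
  have hB : ∀ w ∈ V, padicValRat 2 w < 4 := by
    intro w hw
    by_contra! hpos
    obtain ⟨m, hm, hmax⟩ := V.exists_max_image (padicValRat 2) hV ⟨w, hw⟩
    have hm4 := hpos.trans (hmax w hw)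
    obtain ⟨h0, h1, hv1⟩ := val_pos m (by omega)
    obtain ⟨h8, hv8'⟩ := padicValRat_add_of_lt (p := 2) (x := -8) (y := m) (by norm_num)
      fun _ => by omega
    rw [add_comm] at h8 hv8'
    have := hmax _ (hstable m hm h1)
    rw [padicValRat_doubleInvariant h0 h1 h8] at this
    omega
  have hC : ∀ w ∈ V, padicValRat 2 w = 2 → w + 4 = 0 := by
    intro w hw h2
    by_contra! h4
    set W := {w ∈ V | padicValRat 2 w = 2 ∧ w + 4 ≠ 0}
    obtain ⟨m, ⟨hm, hm2, hm4⟩, hmax⟩ := W.exists_max_image (fun w => padicValRat 2 (w + 4))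
      (hV.subset fun _ h => h.1) ⟨w, hw, h2, h4⟩
    obtain ⟨h0, h1, hv1⟩ := val_pos m (by omega)
    obtain ⟨h8, hv8'⟩ := val_lt m (by omega) h0
    obtain ⟨hd4, hvd4⟩ := padicValRat_doubleInvariant_add_four hm2 h0 hm4
    have hd2 : padicValRat 2 (doubleInvariant m) = 2 := by
      rw [padicValRat_doubleInvariant h0 h1 h8]
      omega
    have := hmax _ ⟨hstable m hm h1, hd2, hd4⟩
    simp only [hvd4] at this
    omega
  by_contra! hne
  obtain ⟨h0, h1, h4, h8⟩ := hne
  have h1 : w + 1 ≠ 0 := fun h => h1 (by linarith)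
  have h4 : w + 4 ≠ 0 := fun h => h4 (by linarith)
  have h8 : w + -8 ≠ 0 := fun h => h8 (by linarith)
  have hlo := hA w hw
  have hhi := hB w hw
  have hne2 : padicValRat 2 w ≠ 2 := fun h => h4 (hC w hw h)
  have hd := hstable w hw h1
  have hlo' := hA _ hd
  have hhi' := hB _ hd
  rw [padicValRat_doubleInvariant h0 h1 h8] at hlo' hhi'
  obtain hv | hv | hv : padicValRat 2 w = 0 ∨ padicValRat 2 w = 1 ∨ padicValRat 2 w = 3 := by omega
  · have := one_le_padicValRat_two_add_one h0 hv h1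
    have := (val_lt w (by omega) h0).2
    omega
  · have := (val_lt w (by omega) h0).2
    have := (val_pos w (by omega)).2.2
    omega
  · have := (val_pos w (by omega)).2.2
    have h16 : 4 ≤ padicValRat 2 (w + -8) := by
      obtain ⟨u, rfl⟩ : ∃ u, w = -8 * u := ⟨w / -8, by ring⟩
      have hu0 : u ≠ 0 := by rintro rfl; simp at h0
      have hu1 : u + 1 ≠ 0 := fun h => h8 (by linear_combination -8 * h)
      rw [padicValRat.mul (by norm_num) hu0] at hv
      rw [show -8 * u + -8 = -8 * (u + 1) by ring, padicValRat.mul (by norm_num) hu1]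
      have := one_le_padicValRat_two_add_one hu0 (by omega) hu1
      omega
    omega

/-- A rational point of `x² = y³ + k` not satisfying one of the equations characterising the
nontrivial torsion forces infinitely many rational points. -/
theorem infinite_points_of_nontorsion {k x y : ℚ} (hk : k ≠ 0) (h : x ^ 2 = y ^ 3 + k)
    (h0 : y ≠ 0) (h1 : y ^ 3 + k ≠ 0) (h4 : y ^ 3 + 4 * k ≠ 0) (h8 : y ^ 3 - 8 * k ≠ 0) :
    {y : ℚ | ∃ x, x ^ 2 = y ^ 3 + k}.Infinite := by
  intro hfin
  have hmem := mem_torsion_of_finite_of_stable (hfin.image fun y => y ^ 3 / k) ?_ ⟨y, ⟨x, h⟩, rfl⟩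
  · rcases hmem with e | e | e | e <;> simp only [div_eq_iff hk] at e
    · exact h0 (pow_eq_zero_iff (n := 3) (by norm_num) |>.mp (by linarith))
    · exact h1 (by linarith)
    · exact h4 (by linarith)
    · exact h8 (by linarith)
  · rintro _ ⟨y, ⟨x, h⟩, rfl⟩ hne
    have hyk : y ^ 3 + k ≠ 0 := fun e => hne (by
      simp only
      rw [show y ^ 3 = -k by linarith, neg_div, div_self hk]; norm_num)
    have hx : x ≠ 0 := by rintro rfl; exact hyk (by rw [← h]; norm_num)
    refine ⟨y * (y ^ 3 - 8 * k) / (4 * x ^ 2),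
      ⟨(y ^ 6 + 20 * y ^ 3 * k - 8 * k ^ 2) / (8 * x ^ 3), ?_⟩, ?_⟩
    · have hk' : k = x ^ 2 - y ^ 3 := by linarith
      rw [hk']
      field_simp
      ring
    · have h3 : y ^ 3 / k + 1 = x ^ 2 / k := by rw [h]; field_simp
      simp only [doubleInvariant, h3]
      field_simp
      ring

/-- A nondegenerate point of the parametrising curve gives a rational point of the surface, whose
fibre contains infinitely many rational points. -/
theorem infinite_fibre_of_degeneracy_ne_zero (a b c d : ℚ) {m E : ℚ}
    (hE : E ^ 2 = (paramCubic a b).eval m) (hP : eval ![m, E] (degeneracy a b c d) ≠ 0) {z : ℚ}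
    (hz : z = eval ![m, E] (zNum a b c d) / eval ![m, E] (uDen a b c)) :
    {y : ℚ | ∃ x, x ^ 2 = y ^ 3 + (z ^ 5 + a * z ^ 3 + b * z ^ 2 + c * z + d)}.Infinite := by
  simp only [degeneracy, map_mul, mul_ne_zero_iff, map_add, map_sub, map_pow, map_ofNat] at hP
  obtain ⟨⟨⟨⟨⟨hD, hF⟩, hY⟩, h1⟩, h4⟩, h8⟩ := hP
  have hK : eval ![m, E] (zNum a b c d) = z * eval ![m, E] (uDen a b c) := by
    rw [hz, div_mul_cancel₀ _ hD]
  have hN : eval ![m, E] (uNum a b c d) = (z + m) * eval ![m, E] (uDen a b c) := by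
    have : uNum a b c d = zNum a b c d + X 0 * uDen a b c := by rw [zNum]; ring
    rw [this, map_add, map_mul, hK]
    simp
    ring
  set D := eval ![m, E] (uDen a b c) with hDdef
  set e := eval ![m, E] eCoeff with he
  set k := z ^ 5 + a * z ^ 3 + b * z ^ 2 + c * z + d with hk
  have hYD : eval ![m, E] (yNum a b c d) = ((z + m) ^ 2 + e) * D ^ 2 := by
    rw [yNum, map_add, map_mul, map_pow, map_pow, hN]
    ring
  have hFD : eval ![m, E] (fNum a b c d) = k * D ^ 5 := by
    simp only [fNum, map_add, map_mul, map_pow, hK, ← hDdef, eval_C]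
    ring
  rw [hYD] at hY h1 h4 h8
  rw [hFD] at hF h1 h4 h8
  set β := eval ![m, E] betaCoeff with hβ
  set γ := eval ![m, E] (gammaCoeff a) with hγ
  refine infinite_points_of_nontorsion (x := (z + m) ^ 3 + (z + m) ^ 2 / 2 + β * (z + m) + γ)
    (y := (z + m) ^ 2 + e) (left_ne_zero_of_mul hF) ?_ (left_ne_zero_of_mul hY)
    (fun h => h1 (by linear_combination D ^ 6 * h)) (fun h => h4 (by linear_combination D ^ 6 * h))
    (fun h => h8 (by linear_combination D ^ 6 * h))
  simp only [uNum, uDen, betaCoeff, gammaCoeff, eCoeff, paramCubic] at hN hDdef he hβ hγ hE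
  simp at hN hDdef he hβ hγ hE
  rw [hDdef] at hN
  rw [he, hβ, hγ, hk]
  linear_combination -(3 / 4) * (z + m) ^ 2 * hE - hN


/-- If the rational points on the curve `Y² = X³ + 135(2a−15)X − 1350(5a+2b−26)` are
infinite, then the rational points on the surface `x² − y³ − f(z) = 0`, where
`f(z) = z⁵ + az³ + bz² + cz + d`, are Zariski dense: every polynomial `g ∈ ℚ[x,y,z]`
vanishing on all rational solutions is divisible by `x² − y³ − f(z)`. -/
theorem stmt_1 (a b c d : ℤ)
    (hinf : {p : ℚ × ℚ |
        p.2 ^ 2 = p.1 ^ 3 + 135 * (2 * (a : ℚ) - 15) * p.1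
          - 1350 * (5 * (a : ℚ) + 2 * (b : ℚ) - 26)}.Infinite)
    (g : MvPolynomial (Fin 3) ℚ)
    (hg : ∀ x₀ y₀ z₀ : ℚ,
        x₀ ^ 2 - y₀ ^ 3
          - (z₀ ^ 5 + (a : ℚ) * z₀ ^ 3 + (b : ℚ) * z₀ ^ 2 + (c : ℚ) * z₀ + (d : ℚ)) = 0 →
        eval ![x₀, y₀, z₀] g = 0) :
    (X 0 ^ 2 - X 1 ^ 3
      - (X 2 ^ 5 + C (a : ℚ) * X 2 ^ 3 + C (b : ℚ) * X 2 ^ 2 + C (c : ℚ) * X 2 + C (d : ℚ))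
      : MvPolynomial (Fin 3) ℚ) ∣ g := by
  set curve : Set (ℚ × ℚ) := {p | p.2 ^ 2 = (paramCubic a b).eval p.1} with hcurve
  have hcurve_inf : curve.Infinite := by
    refine (hinf.image (f := fun p => (p.1 / 30 - 1, p.2 / 45)) ?_).mono ?_
    · rintro ⟨x, y⟩ - ⟨x', y'⟩ - h
      simp only [Prod.mk.injEq] at h ⊢
      exact ⟨by linarith [h.1], by linarith [h.2]⟩
    · rintro _ ⟨⟨x, y⟩, h, rfl⟩
      simp only [Set.mem_ofPred_eq] at h
      simp [hcurve, paramCubic]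
      linear_combination h / 2025
  set ζ : ℚ × ℚ → ℚ := fun p => eval ![p.1, p.2] (zNum a b c d) / eval ![p.1, p.2] (uDen a b c)
  set good : Set (ℚ × ℚ) := {p ∈ curve | eval ![p.1, p.2] (degeneracy a b c d) ≠ 0} with hgood
  have hgood_inf : good.Infinite := by
    obtain ⟨m, E, hE, hP⟩ := exists_real_point_degeneracy a b c d
    refine (hcurve_inf.sdiff (finite_zeros_on_cubic _ (natDegree_paramCubic a b) _ hE hP)).mono ?_
    exact fun p hp => ⟨hp.1, fun h => hp.2 ⟨hp.1, h⟩⟩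
  have hZ : (ζ '' good).Infinite := by
    refine fun hfin => hgood_inf (Set.Finite.of_finite_fibers ζ hfin fun τ _ => ?_)
    obtain ⟨m, E, hE, hP⟩ := exists_real_point_zNum a b c d τ
    refine (finite_zeros_on_cubic _ (natDegree_paramCubic a b) _ hE hP).subset ?_
    rintro p ⟨⟨hp, hdeg⟩, rfl : ζ p = τ⟩
    have hD : eval ![p.1, p.2] (uDen a b c) ≠ 0 := fun h => hdeg (by simp [degeneracy, h])
    refine ⟨hp, ?_⟩
    rw [map_sub, map_mul, eval_C, div_mul_cancel₀ _ hD, sub_self]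
  set f : Polynomial ℚ := Polynomial.X ^ 5 + Polynomial.C (a : ℚ) * Polynomial.X ^ 3
    + Polynomial.C (b : ℚ) * Polynomial.X ^ 2 + Polynomial.C (c : ℚ) * Polynomial.X
    + Polynomial.C (d : ℚ) with hf
  have hfeval (z : ℚ) : f.eval z = z ^ 5 + a * z ^ 3 + b * z ^ 2 + c * z + d := by simp [hf]
  have key := dvd_of_infinite_fibres f hZ ?_ g fun x y z h => hg x y z (by
    rw [h, hfeval]; ring)
  · convert key using 1
    simp only [hf, map_add, map_mul, map_pow, Polynomial.aeval_X, Polynomial.aeval_C, algebraMap_eq]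
    ring
  · rintro _ ⟨p, ⟨hp, hdeg⟩, rfl⟩
    simp only [hfeval]
    exact infinite_fibre_of_degeneracy_ne_zero a b c d hp hdeg rfl
end

section
/- (Hasse) Let E be an elliptic curve in Weierstrass form defined over a finite field 𝔽_q with q elements, and let N_q denote the number of 𝔽_q-points of E, i.e. the number of affine solutions of the Weierstrass equation over 𝔽_q plus one for the point at infinity. Then |N_q − q − 1| ≤ 2√q, equivalently (N_q − q − 1)² ≤ 4q. -/
open Polynomial

namespace WeierstrassCurve

section Forms

variable {R S : Type*} [CommRing R] [CommRing S] (W : WeierstrassCurve R)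

/-- The numerator of `x(P + Q) + x(P - Q)` over the denominator `(a * d - b * c) ^ 2`, where
`x(P) = a / b` and `x(Q) = c / d`. -/
def sumForm (a b c d : R) : R :=
  2 * (a * c) * (a * d + b * c) + W.b₂ * (a * c) * (b * d) + W.b₄ * (a * d + b * c) * (b * d)
    + W.b₆ * (b * d) ^ 2

/-- The numerator of `x(P + Q) * x(P - Q)` over the denominator `(a * d - b * c) ^ 2`, where
`x(P) = a / b` and `x(Q) = c / d`. -/
def prodForm (a b c d : R) : R :=
  (a * c) ^ 2 - W.b₄ * (a * c) * (b * d) - W.b₆ * (a * d + b * c) * (b * d) - W.b₈ * (b * d) ^ 2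

/-- The symmetric triquadratic form vanishing at the `x`-coordinates `a / b`, `c / d`, `e / g` of
three points of `W` that sum to zero. -/
def triForm (a b c d e g : R) : R :=
  (a * d - b * c) ^ 2 * e ^ 2 - W.sumForm a b c d * e * g + W.prodForm a b c d * g ^ 2

lemma map_sumForm (f : R →+* S) (a b c d : R) :
    f (W.sumForm a b c d) = (W.map f).sumForm (f a) (f b) (f c) (f d) := by
  simp [sumForm, map_ofNat]

lemma map_prodForm (f : R →+* S) (a b c d : R) :
    f (W.prodForm a b c d) = (W.map f).prodForm (f a) (f b) (f c) (f d) := by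
  simp [prodForm]

lemma triForm_swap_left (a b c d e g : R) : W.triForm a b c d e g = W.triForm e g c d a b := by
  simp only [triForm, sumForm, prodForm]; ring

lemma triForm_swap_right (a b c d e g : R) : W.triForm a b c d e g = W.triForm a b e g c d := by
  simp only [triForm, sumForm, prodForm]; ring

/-- The Bézout identity between numerator and denominator of the duplication formula. -/
lemma duplication_bezout (x : R) :
    (12 * x ^ 3 - W.b₂ * x ^ 2 - 10 * W.b₄ * x + W.b₂ * W.b₄ - 27 * W.b₆)
        * (4 * x ^ 3 + W.b₂ * x ^ 2 + 2 * W.b₄ * x + W.b₆)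
      - (48 * x ^ 2 + 8 * W.b₂ * x - W.b₂ ^ 2 + 32 * W.b₄)
        * (x ^ 4 - W.b₄ * x ^ 2 - 2 * W.b₆ * x - W.b₈) = W.Δ := by
  simp only [b₂, b₄, b₆, b₈, Δ]; ring

end Forms

/-- On a nonsingular curve the three biquadratic forms have no common zero on `ℙ¹ × ℙ¹`. -/
lemma forms_not_all_zero {k : Type*} [Field k] (W : WeierstrassCurve k) (hΔ : W.Δ ≠ 0)
    {a b c d : k} (hab : a ≠ 0 ∨ b ≠ 0) (hcd : c ≠ 0 ∨ d ≠ 0) :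
    (a * d - b * c) ^ 2 ≠ 0 ∨ W.sumForm a b c d ≠ 0 ∨ W.prodForm a b c d ≠ 0 := by
  by_contra! h
  obtain ⟨h0, h1, h2⟩ := h
  have h0 : a * d = b * c := sub_eq_zero.mp (pow_eq_zero_iff two_ne_zero |>.mp h0)
  by_cases hb : b = 0
  · subst hb
    have ha : a ≠ 0 := by simpa using hab
    have hd : d = 0 := by simpa [ha] using h0
    subst hd
    have hc : c ≠ 0 := by simpa using hcd
    simp [prodForm, ha, hc] at h2
  by_cases hd : d = 0
  · subst hd
    have hc : c ≠ 0 := by simpa using hcd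
    simp [hb, hc] at h0
  obtain ⟨x, rfl⟩ : ∃ x, a = x * b := ⟨a / b, by field_simp⟩
  obtain rfl : c = x * d := mul_left_cancel₀ hb (by linear_combination -h0)
  have hbd : (b * d) ^ 2 ≠ 0 := pow_ne_zero 2 (mul_ne_zero hb hd)
  have h1' : 4 * x ^ 3 + W.b₂ * x ^ 2 + 2 * W.b₄ * x + W.b₆ = 0 :=
    mul_left_cancel₀ hbd (by rw [sumForm] at h1; linear_combination h1)
  have h2' : x ^ 4 - W.b₄ * x ^ 2 - 2 * W.b₆ * x - W.b₈ = 0 :=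
    mul_left_cancel₀ hbd (by rw [prodForm] at h2; linear_combination h2)
  apply hΔ
  rw [← W.duplication_bezout x, h1', h2']
  ring

end WeierstrassCurve

/-- A binary quadratic form with a primitive root splits into linear factors. -/
lemma IsCoprime.exists_factor_quadratic {R : Type*} [CommRing R] [IsDomain R] {a b p q s : R}
    (hab : IsCoprime a b) (h : p * a ^ 2 - q * a * b + s * b ^ 2 = 0) :
    ∃ a' b', p = b * b' ∧ q = a * b' + a' * b ∧ s = a * a' := by
  by_cases hb : b = 0
  · subst hb
    have ha : IsUnit a := isCoprime_zero_right.mp hab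
    have hp : p = 0 := by simpa [ha.ne_zero] using h
    obtain ⟨v, hv⟩ := ha.exists_right_inv
    refine ⟨v * s, v * q, by simpa using hp, ?_, ?_⟩
    · linear_combination -q * hv
    · linear_combination -s * hv
  have hp : b ∣ p := by
    apply (hab.symm.pow_right (n := 2)).dvd_of_dvd_mul_right
    exact ⟨q * a - s * b, by linear_combination h⟩
  obtain ⟨b', rfl⟩ := hp
  have h1 : a * (q - a * b') = s * b :=
    mul_left_cancel₀ hb (by linear_combination -h)
  have hq : b ∣ q - a * b' := hab.symm.dvd_of_dvd_mul_left ⟨s, by linear_combination h1⟩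
  obtain ⟨a', ha'⟩ := hq
  refine ⟨a', b', rfl, by linear_combination ha', mul_left_cancel₀ hb ?_⟩
  linear_combination -h1 + a * ha'

namespace Polynomial

/-- `P` has degree at most `n`, with coefficient `x` in degree `n`. -/
def HasTop {R : Type*} [Semiring R] (n : ℕ) (P : R[X]) (x : R) : Prop :=
  P.natDegree ≤ n ∧ P.coeff n = x

namespace HasTop

variable {R : Type*} [CommRing R] {m n : ℕ} {P Q : R[X]} {x y : R}

lemma add (hP : HasTop n P x) (hQ : HasTop n Q y) : HasTop n (P + Q) (x + y) :=
  ⟨natDegree_add_le_of_degree_le hP.1 hQ.1, by rw [coeff_add, hP.2, hQ.2]⟩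

lemma sub (hP : HasTop n P x) (hQ : HasTop n Q y) : HasTop n (P - Q) (x - y) :=
  ⟨natDegree_sub_le_of_le hP.1 hQ.1 |>.trans (max_self n).le, by rw [coeff_sub, hP.2, hQ.2]⟩

lemma mul (hP : HasTop m P x) (hQ : HasTop n Q y) : HasTop (m + n) (P * Q) (x * y) :=
  ⟨natDegree_mul_le_of_le hP.1 hQ.1, by
    rw [coeff_mul_add_eq_of_natDegree_le hP.1 hQ.1, hP.2, hQ.2]⟩

lemma sq (hP : HasTop n P x) : HasTop (n + n) (P ^ 2) (x ^ 2) := by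
  simpa only [pow_two] using hP.mul hP

lemma C_mul (c : R) (hP : HasTop n P x) : HasTop n (C c * P) (c * x) :=
  ⟨(natDegree_C_mul_le c P).trans hP.1, by rw [coeff_C_mul, hP.2]⟩

end HasTop

/-- The map to the projective line given by the pair `(A, B)` has degree `n`,
provided that `A` and `B` are coprime. -/
def HasHeight {R : Type*} [Semiring R] (n : ℕ) (A B : R[X]) : Prop :=
  A.natDegree ≤ n ∧ B.natDegree ≤ n ∧ (A.coeff n ≠ 0 ∨ B.coeff n ≠ 0)

lemma exists_hasHeight {R : Type*} [Semiring R] {A B : R[X]} (h : A ≠ 0 ∨ B ≠ 0) :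
    ∃ n, HasHeight n A B := by
  have key : ∀ P : R[X], P ≠ 0 → P.coeff P.natDegree ≠ 0 := fun P hP ↦ by simpa using hP
  rcases le_total A.natDegree B.natDegree with hle | hle
  · by_cases hB : B = 0
    · have hA : A ≠ 0 := h.resolve_right (not_not.mpr hB)
      exact ⟨A.natDegree, le_rfl, by simp [hB], Or.inl (key A hA)⟩
    · exact ⟨B.natDegree, hle, le_rfl, Or.inr (key B hB)⟩
  · by_cases hA : A = 0
    · have hB : B ≠ 0 := h.resolve_left (not_not.mpr hA)
      exact ⟨B.natDegree, by simp [hA], le_rfl, Or.inr (key B hB)⟩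
    · exact ⟨A.natDegree, le_rfl, hle, Or.inl (key A hA)⟩

/-- The degree of a triple of polynomials is determined by a nonvanishing top coefficient. -/
lemma le_of_hasTop_triple {R : Type*} [CommRing R] {m n : ℕ} {P Q S : R[X]} {x y z x' y' z' : R}
    (hP : HasTop m P x) (hQ : HasTop m Q y) (hS : HasTop m S z)
    (hP' : HasTop n P x') (hQ' : HasTop n Q y') (hS' : HasTop n S z')
    (h : x ≠ 0 ∨ y ≠ 0 ∨ z ≠ 0) : m ≤ n := by
  by_contra! hlt
  have key : ∀ (T : R[X]) (u v : R), HasTop m T u → HasTop n T v → u = 0 := fun T u v hu hv ↦ by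
    rw [← hu.2, coeff_eq_zero_of_natDegree_lt (hv.1.trans_lt hlt)]
  rcases h with h | h | h
  · exact h (key P x x' hP hP')
  · exact h (key Q y y' hQ hQ')
  · exact h (key S z z' hS hS')

end Polynomial

namespace WeierstrassCurve

variable {k : Type*} [Field k] (W : WeierstrassCurve k)

lemma hasTop_forms {m n : ℕ} {A B C' D : k[X]} {a b c d : k} (hA : HasTop m A a)
    (hB : HasTop m B b) (hC : HasTop n C' c) (hD : HasTop n D d) :
    HasTop (m + n + (m + n)) ((A * D - B * C') ^ 2) ((a * d - b * c) ^ 2) ∧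
    HasTop (m + n + (m + n)) ((W.map C).sumForm A B C' D) (W.sumForm a b c d) ∧
    HasTop (m + n + (m + n)) ((W.map C).prodForm A B C' D) (W.prodForm a b c d) := by
  have hs := hA.mul hC
  have hu := hB.mul hD
  have hpr := (hA.mul hD).add (hB.mul hC)
  refine ⟨((hA.mul hD).sub (hB.mul hC)).sq, ?_, ?_⟩
  · have := (((((hs.C_mul 2).mul hpr).add ((hs.C_mul W.b₂).mul hu)).add
      ((hpr.C_mul W.b₄).mul hu)).add (hu.sq.C_mul W.b₆))
    simpa [sumForm, C_ofNat] using this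
  · have := (((hs.sq.sub ((hs.C_mul W.b₄).mul hu)).sub
      ((hpr.C_mul W.b₆).mul hu)).sub (hu.sq.C_mul W.b₈))
    simpa [prodForm] using this

/-- The factor complementary to a primitive root of the form `triForm A B X 1` is again primitive,
and heights satisfy the parallelogram law. -/
lemma exists_next (hΔ : W.Δ ≠ 0) {A B A' B' : k[X]} {m n : ℕ} (hAB : IsCoprime A B)
    (hAB' : IsCoprime A' B') (hm : HasHeight m A B) (hn : HasHeight n A' B')
    (h : (W.map C).triForm A B X 1 A' B' = 0) :
    ∃ A'' B'' : k[X], ∃ l : ℕ, IsCoprime A'' B'' ∧ HasHeight l A'' B'' ∧ l + n = 2 * m + 2 ∧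
      (A * 1 - B * X) ^ 2 = B' * B'' ∧ (W.map C).sumForm A B X 1 = A' * B'' + A'' * B' ∧
      (W.map C).prodForm A B X 1 = A' * A'' := by
  obtain ⟨A'', B'', h0, h1, h2⟩ := hAB'.exists_factor_quadratic h
  have hcop : IsCoprime A'' B'' := by
    let K := AlgebraicClosure k
    rw [isCoprime_iff_aeval_ne_zero_of_isAlgClosed k K] at hAB ⊢
    intro x
    by_contra! hx
    let φ : k[X] →+* K := (aeval x : k[X] →ₐ[k] K)
    have hφ : (W.map C).map φ = W.map (algebraMap k K) := by
      rw [map_map]; congr 1; ext; simp [φ]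
    have hΔ' : (W.map (algebraMap k K)).Δ ≠ 0 := by simpa using hΔ
    have e1 : φ A'' = 0 := hx.1
    have e2 : φ B'' = 0 := hx.2
    have h0' := congrArg φ h0
    have h1' := congrArg φ h1
    have h2' := congrArg φ h2
    rw [map_sumForm, hφ] at h1'
    rw [map_prodForm, hφ] at h2'
    simp only [map_mul, map_add, map_sub, map_pow, e1, e2, mul_zero, zero_mul, add_zero]
      at h0' h1' h2'
    rcases forms_not_all_zero (W.map (algebraMap k K)) hΔ' (hAB x)
      (Or.inr (by simp) : φ X ≠ 0 ∨ φ 1 ≠ 0) with h | h | h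
    exacts [h h0', h h1', h h2']
  have hne : A'' ≠ 0 ∨ B'' ≠ 0 := by
    by_contra! hz
    rw [hz.1, hz.2] at hcop
    exact not_isCoprime_zero_zero hcop
  obtain ⟨l, hl⟩ := exists_hasHeight hne
  refine ⟨A'', B'', l, hcop, hl, ?_, h0, h1, h2⟩
  have t1 : HasTop n A' _ := ⟨hn.1, rfl⟩
  have t2 : HasTop n B' _ := ⟨hn.2.1, rfl⟩
  have t3 : HasTop l A'' _ := ⟨hl.1, rfl⟩
  have t4 : HasTop l B'' _ := ⟨hl.2.1, rfl⟩
  have tX : HasTop 1 (X : k[X]) 1 := ⟨natDegree_X_le, coeff_X_one⟩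
  have t1' : HasTop 1 (1 : k[X]) 0 := ⟨by simp, by simp [coeff_one]⟩
  obtain ⟨u0, u1, u2⟩ := W.hasTop_forms (⟨hm.1, rfl⟩ : HasTop m A _) ⟨hm.2.1, rfl⟩ tX t1'
  have v0 := t2.mul t4
  have v1 := (t1.mul t4).add (add_comm l n ▸ t3.mul t2)
  have v2 := t1.mul t3
  rw [← h0] at v0
  rw [← h1] at v1
  rw [← h2] at v2
  have i1 := le_of_hasTop_triple u0 u1 u2 v0 v1 v2
    (W.forms_not_all_zero hΔ hm.2.2 (Or.inl one_ne_zero))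
  have i2 := le_of_hasTop_triple v0 v1 v2 u0 u1 u2 (by
    by_contra! hz
    obtain ⟨z0, z1, z2⟩ := hz
    rcases mul_eq_zero.mp z0 with z | z <;> rcases mul_eq_zero.mp z2 with w | w <;>
      simp only [z, w, zero_mul, mul_zero, add_zero, zero_add, mul_eq_zero] at z1 <;>
      have a1 := hn.2.2 <;> have a2 := hl.2.2 <;> tauto)
  omega

/-- Two adjacent terms of the sequence cannot both be constant. -/
lemma height_add_pos (hΔ : W.Δ ≠ 0) {A B A' B' : k[X]} {m n : ℕ}
    (hm : HasHeight m A B) (hn : HasHeight n A' B')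
    (h : (W.map C).triForm A B X 1 A' B' = 0) : 0 < m + n := by
  by_contra! h0
  obtain ⟨rfl, rfl⟩ : m = 0 ∧ n = 0 := by omega
  rw [triForm_swap_right] at h
  obtain ⟨hA, hB, hm⟩ := hm
  obtain ⟨hA', hB', hn⟩ := hn
  rw [eq_C_of_natDegree_le_zero hA, eq_C_of_natDegree_le_zero hB,
    eq_C_of_natDegree_le_zero hA', eq_C_of_natDegree_le_zero hB', triForm, ← map_sumForm,
    ← map_prodForm, ← C_mul, ← C_mul, ← C_sub, ← C_pow] at h
  have key : ∀ p q r : k, C p * X ^ 2 - C q * X * 1 + C r * 1 ^ 2 = 0 → p = 0 ∧ q = 0 ∧ r = 0 := by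
    intro p q r hpqr
    have c0 := congrArg (coeff · 0) hpqr
    have c1 := congrArg (coeff · 1) hpqr
    have c2 := congrArg (coeff · 2) hpqr
    simp [coeff_X, coeff_C, -map_pow] at c0 c1 c2
    exact ⟨c2, c1, c0⟩
  obtain ⟨c0, c1, c2⟩ := key _ _ _ h
  rcases W.forms_not_all_zero hΔ hm hn with h | h | h
  exacts [h c0, h c1, h c2]

/-- The heights along the sequence of points `P + n Q` with `Q` generic form a quadratic
polynomial in `n`. -/
lemma exists_height_seq (hΔ : W.Δ ≠ 0) {A B A' B' : k[X]} {m l : ℕ} (hAB : IsCoprime A B)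
    (hAB' : IsCoprime A' B') (hm : HasHeight m A B) (hl : HasHeight l A' B')
    (h : (W.map C).triForm A B X 1 A' B' = 0) (n : ℕ) :
    ∃ P Q P' Q' : k[X], ∃ u v : ℕ, IsCoprime P Q ∧ IsCoprime P' Q' ∧ HasHeight u P Q ∧
      HasHeight v P' Q' ∧ (W.map C).triForm P Q X 1 P' Q' = 0 ∧
      (u : ℤ) = n ^ 2 + (l - m - 1) * n + m ∧
      (v : ℤ) = (n + 1) ^ 2 + (l - m - 1) * (n + 1) + m := by
  induction n with
  | zero => exact ⟨A, B, A', B', m, l, hAB, hAB', hm, hl, h, by simp, by push_cast; ring⟩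
  | succ n ih =>
    obtain ⟨P, Q, P', Q', u, v, hPQ, hPQ', hu, hv, htri, eu, ev⟩ := ih
    rw [triForm_swap_left] at htri
    obtain ⟨P'', Q'', w, hcop, hw, hsum, h0, h1, h2⟩ := W.exists_next hΔ hPQ' hPQ hv hu htri
    refine ⟨P', Q', P'', Q'', v, w, hPQ', hcop, hv, hw, ?_, ?_, ?_⟩
    · rw [triForm, h0, h1, h2]; ring
    · push_cast; exact ev
    · have : (w : ℤ) + u = 2 * v + 2 := by exact_mod_cast hsum
      push_cast
      linear_combination this - eu + 2 * ev

end WeierstrassCurve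

/-- A monic integral quadratic that is nonnegative on `ℤ` and does not vanish at two adjacent
integers has nonpositive discriminant; only one sign of the linear term needs to be considered. -/
lemma sq_le_four_mul_of_nonneg {c q : ℤ} (hc : c ≤ 0)
    (h : ∀ n : ℕ, (0 : ℤ) ≤ n ^ 2 + c * n + q)
    (h' : ∀ n : ℕ, (0 : ℤ) < (n ^ 2 + c * n + q) + ((n + 1) ^ 2 + c * (n + 1) + q)) :
    c ^ 2 ≤ 4 * q := by
  obtain ⟨s, rfl⟩ : ∃ s : ℕ, c = -s := ⟨c.natAbs, by omega⟩
  obtain ⟨n, rfl | rfl⟩ := Nat.even_or_odd' s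
  · have := h n
    push_cast at *
    linarith
  · have := h' n
    push_cast at *
    nlinarith

section Frobenius

/-- Modulo a monic quadratic polynomial, every power of the variable is linear. -/
lemma Polynomial.exists_pow_eq_linear_add_mul {R : Type*} [CommRing R] (h f : R) (n : ℕ) :
    ∃ u v : R, ∃ Q : R[X], X ^ n = C u + C v * X + (X ^ 2 + C h * X - C f) * Q := by
  induction n with
  | zero => exact ⟨1, 0, 0, by simp⟩
  | succ n ih =>
    obtain ⟨u, v, Q, hQ⟩ := ih
    refine ⟨v * f, u - h * v, X * Q + C v, ?_⟩
    rw [pow_succ, hQ]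
    simp only [C_mul, C_sub]
    ring

lemma IsAlgClosed.exists_quadratic_root {K : Type*} [Field K] [IsAlgClosed K] (h f : K) :
    ∃ z, z ^ 2 + h * z = f := by
  have hd : (C 1 * X ^ 2 + C h * X + C (-f) : K[X]).degree = 2 := degree_quadratic one_ne_zero
  obtain ⟨z, hz⟩ := IsAlgClosed.exists_root (C 1 * X ^ 2 + C h * X + C (-f) : K[X])
    (by rw [hd]; decide)
  refine ⟨z, ?_⟩
  simp [IsRoot] at hz
  linear_combination hz

variable {F : Type*} [Field F] [Fintype F]

lemma FiniteField.splits_X_pow_card_sub_X_self :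
    (X ^ Fintype.card F - X : F[X]).Splits := by
  rw [splits_iff_card_roots, FiniteField.roots_X_pow_card_sub_X,
    FiniteField.X_pow_card_sub_X_natDegree_eq F Fintype.one_lt_card]
  rfl

lemma FiniteField.exists_algebraMap_eq_of_pow_card_eq {K : Type*} [Field K] [Algebra F K] {z : K}
    (hz : z ^ Fintype.card F = z) : ∃ b : F, algebraMap F K b = z := by
  have hne : (X ^ Fintype.card F - X : F[X]) ≠ 0 :=
    FiniteField.X_pow_card_sub_X_ne_zero F Fintype.one_lt_card
  exact FiniteField.splits_X_pow_card_sub_X_self.mem_range_of_isRoot hne (by simp [hz])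

/-- The `q`-power of a root of `y ^ 2 + h * y = f` over `F[X]`, written as `U + V * y`, together
with its trace and norm. -/
lemma exists_frobenius_coeffs.{u} {F : Type u} [Field F] [Fintype F] (h f : F[X]) :
    ∃ U V : F[X], 2 * U + h ^ Fintype.card F = V * h ∧
      U ^ 2 + h ^ Fintype.card F * U + V ^ 2 * f = f ^ Fintype.card F ∧
      ∀ (K : Type u) [Field K] [Algebra F K] (a : F) (z : K),
        z ^ 2 + algebraMap F K (h.eval a) * z = algebraMap F K (f.eval a) →
        z ^ Fintype.card F = algebraMap F K (U.eval a) + algebraMap F K (V.eval a) * z := by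
  obtain ⟨U, V, Q, hQ⟩ := exists_pow_eq_linear_add_mul h f (Fintype.card F)
  have key : ∀ {S : Type u} [CommRing S] (φ : F[X] →+* S) (z : S),
      z ^ 2 + φ h * z = φ f → z ^ Fintype.card F = φ U + φ V * z := by
    intro S _ φ z hz
    have := congrArg (eval₂ φ z) hQ
    simp only [eval₂_add, eval₂_sub, eval₂_mul, eval₂_pow, eval₂_X, eval₂_C] at this
    rw [this]
    linear_combination (eval₂ φ z Q) * hz
  let L := AlgebraicClosure (FractionRing F[X])
  let φ : F[X] →+* L := (algebraMap (FractionRing F[X]) L).comp (algebraMap F[X] _)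
  have hφ : Function.Injective φ :=
    (algebraMap (FractionRing F[X]) L).injective.comp (IsFractionRing.injective F[X] _)
  obtain ⟨y, hy⟩ := IsAlgClosed.exists_quadratic_root (φ h) (φ f)
  have hy' : (-φ h - y) ^ 2 + φ h * (-φ h - y) = φ f := by linear_combination hy
  have k1 := key φ y hy
  have k2 := key φ _ hy'
  let σ := FiniteField.frobeniusAlgHom F L
  have hσ : ∀ x : L, x ^ Fintype.card F = σ x := fun x ↦ rfl
  have s2 : φ h ^ Fintype.card F = σ (φ h) := hσ _
  have s3 : φ f ^ Fintype.card F = σ (φ f) := hσ _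
  have s4 : σ (φ f) = σ y ^ 2 + σ (φ h) * σ y := by rw [← hy]; simp
  rw [hσ] at k1 k2
  simp only [map_sub, map_neg] at k2
  have e1 : 2 * φ U + σ (φ h) = φ V * φ h := by linear_combination -k1 - k2
  refine ⟨U, V, hφ ?_, hφ ?_, ?_⟩
  · simp only [map_add, map_mul, map_pow, map_ofNat, s2]
    exact e1
  · simp only [map_add, map_mul, map_pow, s2, s3]
    rw [s4, k1, ← hy]
    linear_combination (-φ V * y) * e1
  · intro K _ _ a z hz
    exact key ((algebraMap F K).comp (evalRingHom a)) z hz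

/-- The number of roots of `y ^ 2 + c * y = e` in a finite field, in terms of the action of
Frobenius on the roots. -/
lemma card_quadratic_roots_trichotomy [DecidableEq F] {c e u v : F}
    (htr : 2 * u + c = v * c)
    (hF : ∀ z : F, z ^ 2 + c * z = e → z = u + v * z)
    (hK : ∀ z : AlgebraicClosure F, z ^ 2 + algebraMap F _ c * z = algebraMap F _ e →
      z ^ Fintype.card F = algebraMap F _ u + algebraMap F _ v * z) :
    let m := (Finset.univ.filter fun y : F ↦ y ^ 2 + c * y = e).card
    let r := -u * c + v * (c ^ 2 + 2 * e) + 2 * e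
    let r' := -u * c - 2 * v * e + 2 * e
    (m = 2 ∧ r ≠ 0) ∨ (m = 1 ∧ r = 0 ∧ r' = 0) ∨ (m = 0 ∧ r' ≠ 0) := by
  intro m r r'
  by_cases hb : ∃ b : F, b ^ 2 + c * b = e
  · obtain ⟨b, hb⟩ := hb
    have hset : (Finset.univ.filter fun y : F ↦ y ^ 2 + c * y = e) = {b, -c - b} := by
      ext y
      simp only [Finset.mem_filter, Finset.mem_univ, true_and, Finset.mem_insert,
        Finset.mem_singleton]
      rw [← sub_eq_zero, ← sub_eq_zero (a := y) (b := b), ← sub_eq_zero (a := y) (b := -c - b),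
        ← mul_eq_zero, ← hb]
      ring_nf
    have h1 := hF b hb
    have h2 := hF (-c - b) (by linear_combination hb)
    by_cases hbb : b = -c - b
    · right; left
      obtain rfl : c = -2 * b := by linear_combination hbb
      refine ⟨?_, ?_, ?_⟩
      · simp only [m, hset, ← hbb, Finset.pair_eq_singleton, Finset.card_singleton]
      · simp only [r, ← hb]; linear_combination (-2 * b) * h1
      · simp only [r', ← hb]; linear_combination (-2 * b) * h1
    · left
      refine ⟨?_, ?_⟩
      · simp only [m, hset, Finset.card_pair hbb]
      · have hv : v = 1 := by
          apply mul_right_cancel₀ (sub_ne_zero.mpr hbb)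
          linear_combination h2 - h1
        have hu : u = 0 := by rw [hv] at h1; linear_combination -h1
        have : r = (b - (-c - b)) ^ 2 := by
          simp only [r, hu, hv, ← hb]; ring
        rw [this]
        exact pow_ne_zero 2 (sub_ne_zero.mpr hbb)
  · right; right
    push Not at hb
    refine ⟨by simpa [m, Finset.filter_eq_empty_iff] using hb, ?_⟩
    let K := AlgebraicClosure F
    let ι := algebraMap F K
    obtain ⟨z, hz⟩ := IsAlgClosed.exists_quadratic_root (ι c) (ι e)
    have hzq : z ^ Fintype.card F = ι u + ι v * z := hK z hz
    have hne : z ^ Fintype.card F ≠ z := by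
      intro h
      obtain ⟨b, hbz⟩ := FiniteField.exists_algebraMap_eq_of_pow_card_eq h
      apply hb b
      apply ι.injective
      rw [← hz, ← hbz]
      simp [ι, K]
    have hroot : (z ^ Fintype.card F) ^ 2 + ι c * z ^ Fintype.card F = ι e := by
      have := congrArg (FiniteField.frobeniusAlgHom F K) hz
      simp only [map_add, map_mul, map_pow, FiniteField.coe_frobeniusAlgHom] at this
      simpa [ι, ← map_pow, FiniteField.pow_card] using this
    have hconj : z ^ Fintype.card F = -ι c - z := by
      have : (z ^ Fintype.card F - z) * (z ^ Fintype.card F - (-ι c - z)) = 0 := by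
        linear_combination hroot - hz
      exact sub_eq_zero.mp ((mul_eq_zero.mp this).resolve_left (sub_ne_zero.mpr hne))
    have htr' : 2 * ι u + ι c = ι v * ι c := by simpa [map_ofNat] using congrArg ι htr
    have hu : ι u = -ι c - z - ι v * z := by linear_combination hconj - hzq
    intro hr
    have hr' : -(ι u * ι c) - 2 * ι v * ι e + 2 * ι e = 0 := by
      simpa [r', map_ofNat] using congrArg ι hr
    have hsq : (ι c + 2 * z) ^ 2 = 0 := by
      rw [← hz, hu] at hr'
      rw [hu] at htr'
      linear_combination hr' - z * htr'
    apply hne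
    rw [hconj]
    linear_combination -(pow_eq_zero_iff two_ne_zero |>.mp hsq)

end Frobenius

lemma Polynomial.Splits.sum_rootMultiplicity {F : Type*} [Field F] [Fintype F] {P : F[X]}
    (hP : P.Splits) : ∑ a, P.rootMultiplicity a = P.natDegree := by
  classical
  rw [hP.natDegree_eq_card_roots, ← Multiset.sum_count_eq_card (s := Finset.univ) (by simp)]
  simp

namespace WeierstrassCurve

/-- The two candidates for the numerator of `x(P + Q)` and `x(P - Q)`, where `x(P) = t` and
`x(Q) = x`, have the right sum: here `U + V * y` is the `y`-coordinate of `P`. -/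
lemma sumForm_eq_of_trace {R : Type*} [CommRing R] (W : WeierstrassCurve R) {t x U V h h' f f' : R}
    (eh : h = W.a₁ * x + W.a₃) (eh' : h' = W.a₁ * t + W.a₃)
    (ef : f = x ^ 3 + W.a₂ * x ^ 2 + W.a₄ * x + W.a₆)
    (ef' : f' = t ^ 3 + W.a₂ * t ^ 2 + W.a₄ * t + W.a₆) (htr : 2 * U + h' = V * h) :
    W.sumForm t 1 x 1 =
      (-U * h + V * (h ^ 2 + 2 * f) + f' + f - (W.a₂ + x + t) * (t * 1 - 1 * x) ^ 2)
      + (-U * h - 2 * V * f + f' + f - (W.a₂ + x + t) * (t * 1 - 1 * x) ^ 2) := by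
  have : W.sumForm t 1 x 1 = h * h' + 2 * f + 2 * f' - 2 * (W.a₂ + x + t) * (t - x) ^ 2 := by
    rw [eh, eh', ef, ef']
    simp only [sumForm, b₂, b₄, b₆]
    ring
  rw [this]
  linear_combination h * htr

lemma prodForm_eq_of_trace {R : Type*} [CommRing R] (W : WeierstrassCurve R) {t x U V h h' f f' : R}
    (eh : h = W.a₁ * x + W.a₃) (eh' : h' = W.a₁ * t + W.a₃)
    (ef : f = x ^ 3 + W.a₂ * x ^ 2 + W.a₄ * x + W.a₆)
    (ef' : f' = t ^ 3 + W.a₂ * t ^ 2 + W.a₄ * t + W.a₆) (htr : 2 * U + h' = V * h)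
    (hnm : U ^ 2 + h' * U + V ^ 2 * f = f') :
    (t * 1 - 1 * x) ^ 2 * W.prodForm t 1 x 1 =
      (-U * h + V * (h ^ 2 + 2 * f) + f' + f - (W.a₂ + x + t) * (t * 1 - 1 * x) ^ 2)
      * (-U * h - 2 * V * f + f' + f - (W.a₂ + x + t) * (t * 1 - 1 * x) ^ 2) := by
  have hsum : (-U * h + V * (h ^ 2 + 2 * f) + f' + f) + (-U * h - 2 * V * f + f' + f)
      = h * h' + 2 * f + 2 * f' := by
    linear_combination -h * htr
  have hprod : (-U * h + V * (h ^ 2 + 2 * f) + f' + f) * (-U * h - 2 * V * f + f' + f)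
      = (f + f') ^ 2 + (f + f') * h * h' - h ^ 2 * f' - 4 * f * f' - f * h' ^ 2 := by
    have h1 : (-U * h + V * (h ^ 2 + 2 * f) + f' + f) = f + f' + U * h + h * h' + 2 * V * f := by
      linear_combination -h * htr
    rw [h1]
    linear_combination -(h ^ 2 + 4 * f) * hnm + f * (2 * U + h' - V * h) * htr
  have : (t - x) ^ 2 * W.prodForm t 1 x 1 =
      ((f + f') ^ 2 + (f + f') * h * h' - h ^ 2 * f' - 4 * f * f' - f * h' ^ 2)
      - (W.a₂ + x + t) * (t - x) ^ 2 * (h * h' + 2 * f + 2 * f')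
      + ((W.a₂ + x + t) * (t - x) ^ 2) ^ 2 := by
    rw [eh, eh', ef, ef']
    simp only [prodForm, b₄, b₆, b₈]
    ring
  linear_combination this - hprod + (W.a₂ + x + t) * (t - x) ^ 2 * hsum

variable {F : Type*} [Field F] [Fintype F] (W : WeierstrassCurve F)

lemma card_points_eq_sum [DecidableEq F] : Nat.card {p : F × F |
      p.2 ^ 2 + W.a₁ * p.1 * p.2 + W.a₃ * p.2
        = p.1 ^ 3 + W.a₂ * p.1 ^ 2 + W.a₄ * p.1 + W.a₆} =
    ∑ a : F, (Finset.univ.filter fun y : F ↦ y ^ 2 + (W.a₁ * a + W.a₃) * y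
      = a ^ 3 + W.a₂ * a ^ 2 + W.a₄ * a + W.a₆).card := by
  rw [← Finset.card_sigma, Nat.card_eq_fintype_card, ← Fintype.card_coe]
  refine Fintype.card_congr ⟨fun p ↦ ⟨⟨p.1.1, p.1.2⟩, ?_⟩, fun p ↦ ⟨⟨p.1.1, p.1.2⟩, ?_⟩,
    fun _ ↦ rfl, fun _ ↦ rfl⟩
  · have := p.2
    simp only [Set.mem_ofPred_eq] at this
    simp only [Finset.mem_sigma, Finset.mem_univ, Finset.mem_filter, true_and]
    linear_combination this
  · have := p.2
    simp only [Finset.mem_sigma, Finset.mem_univ, Finset.mem_filter, true_and] at this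
    simp only [Set.mem_ofPred_eq]
    linear_combination this

lemma natDegree_eq_succ_of_forms {F : Type*} [Field F] (W : WeierstrassCurve F) {A B A' B' : F[X]} {q : ℕ} (hq : 1 < q)
    (h0 : (X ^ q * 1 - 1 * X : F[X]) ^ 2 = B * B')
    (h1 : (W.map C).sumForm (X ^ q) 1 X 1 = A * B' + A' * B)
    (h2 : (W.map C).prodForm (X ^ q) 1 X 1 = A * A') : A.natDegree = B.natDegree + 1 := by
  have tT : HasTop q (X ^ q : F[X]) 1 := ⟨natDegree_X_pow_le q, coeff_X_pow_self q⟩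
  have tO : HasTop q (1 : F[X]) 0 := ⟨by simp, by simp [coeff_one]; omega⟩
  have tX : HasTop 1 (X : F[X]) 1 := ⟨natDegree_X_le, coeff_X_one⟩
  have tO' : HasTop 1 (1 : F[X]) 0 := ⟨by simp, by simp [coeff_one]⟩
  obtain ⟨-, t1, t2⟩ := W.hasTop_forms tT tO tX tO'
  rw [h1, show W.sumForm 1 0 1 0 = 0 by simp [sumForm]] at t1
  rw [h2, show W.prodForm 1 0 1 0 = 1 by simp [prodForm]] at t2
  have hBB : B * B' ≠ 0 := by
    rw [← h0]
    exact pow_ne_zero 2 (by simpa using FiniteField.X_pow_card_sub_X_ne_zero F hq)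
  have hAA : A * A' ≠ 0 := by
    intro h
    have := t2.2
    rw [h, coeff_zero] at this
    exact zero_ne_one this
  have dB : B.natDegree + B'.natDegree = 2 * q := by
    rw [← natDegree_mul (left_ne_zero_of_mul hBB) (right_ne_zero_of_mul hBB), ← h0, natDegree_pow,
      mul_one, one_mul, FiniteField.X_pow_card_sub_X_natDegree_eq F hq]
  have dA : A.natDegree + A'.natDegree = 2 * q + 2 := by
    rw [← natDegree_mul (left_ne_zero_of_mul hAA) (right_ne_zero_of_mul hAA),
      natDegree_eq_of_le_of_coeff_ne_zero t2.1 (by rw [t2.2]; exact one_ne_zero)]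
    ring
  have dS : (A * B' + A' * B).natDegree < 2 * q + 2 := by
    rw [show 2 * q + 2 = q + 1 + (q + 1) by ring]
    refine lt_of_le_of_ne t1.1 fun h ↦ ?_
    have h3 := t1.2
    rw [← h, coeff_natDegree, leadingCoeff_eq_zero] at h3
    rw [h3, natDegree_zero] at h
    omega
  have d1 := natDegree_mul (left_ne_zero_of_mul hAA) (right_ne_zero_of_mul hBB)
  have d2 := natDegree_mul (right_ne_zero_of_mul hAA) (left_ne_zero_of_mul hBB)
  rcases lt_trichotomy (A * B').natDegree (A' * B).natDegree with h | h | h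
  · have := natDegree_add_eq_right_of_natDegree_lt h
    omega
  · omega
  · have := natDegree_add_eq_left_of_natDegree_lt h
    omega

/-- The difference of the Frobenius and the identity has degree equal to the number of points. -/
lemma exists_hasHeight_card (hΔ : W.Δ ≠ 0) :
    ∃ A B : F[X], IsCoprime A B ∧
      (W.map C).triForm (X ^ Fintype.card F) 1 X 1 A B = 0 ∧
      HasHeight (Nat.card {p : F × F |
        p.2 ^ 2 + W.a₁ * p.1 * p.2 + W.a₃ * p.2
          = p.1 ^ 3 + W.a₂ * p.1 ^ 2 + W.a₄ * p.1 + W.a₆} + 1) A B := by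
  classical
  obtain ⟨q, hq⟩ : ∃ q, Fintype.card F = q := ⟨_, rfl⟩
  have hq1 : 1 < q := hq ▸ Fintype.one_lt_card
  have hpow : ∀ a : F, a ^ q = a := hq ▸ FiniteField.pow_card
  have hexp : ∀ P : F[X], P ^ q = expand F q P := fun P ↦ by rw [← hq, FiniteField.expand_card]
  let h : F[X] := C W.a₁ * X + C W.a₃
  let f : F[X] := X ^ 3 + C W.a₂ * X ^ 2 + C W.a₄ * X + C W.a₆
  obtain ⟨U, V, htr, hnm, hroot⟩ := exists_frobenius_coeffs h f
  rw [hq] at htr hnm ⊢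
  have eh : h ^ q = C W.a₁ * X ^ q + C W.a₃ := by simp [hexp h, h]
  have ef : f ^ q = (X ^ q) ^ 3 + C W.a₂ * (X ^ q) ^ 2 + C W.a₄ * X ^ q + C W.a₆ := by
    simp [hexp f, f]
  have hS := (W.map C).sumForm_eq_of_trace (x := X) (h := h) (f := f) rfl eh rfl ef htr
  have hP := (W.map C).prodForm_eq_of_trace (x := X) (h := h) (f := f) rfl eh rfl ef htr hnm
  set D : F[X] := (X ^ q * 1 - 1 * X) ^ 2 with hD
  set c : F[X] := (W.map C).a₂ + X + X ^ q
  set N₁ : F[X] := -U * h + V * (h ^ 2 + 2 * f) + f ^ q + f - c * D with hN₁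
  set N₂ : F[X] := -U * h - 2 * V * f + f ^ q + f - c * D with hN₂
  have hD0 : D ≠ 0 :=
    pow_ne_zero 2 (by simpa using FiniteField.X_pow_card_sub_X_ne_zero F hq1)
  obtain ⟨A, B, hA, hB, hAB⟩ : ∃ A B : F[X], N₁ = gcd N₁ D * A ∧ D = gcd N₁ D * B ∧
      IsCoprime A B := by
    obtain ⟨A, B, h1, h2, h3⟩ := extract_gcd N₁ D
    exact ⟨A, B, h1, h2, (gcd_isUnit_iff A B).mp h3⟩
  set g := gcd N₁ D
  have hg0 : g ≠ 0 := by rintro hg; rw [hg, zero_mul] at hB; exact hD0 hB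
  have hB0 : B ≠ 0 := by rintro rfl; rw [mul_zero] at hB; exact hD0 hB
  have htri : (W.map C).triForm (X ^ q) 1 X 1 A B = 0 := by
    apply mul_left_cancel₀ (pow_ne_zero 2 hg0)
    rw [triForm, ← hD, hS, mul_zero]
    have : D * N₁ ^ 2 - (N₁ + N₂) * N₁ * D + (W.map C).prodForm (X ^ q) 1 X 1 * D ^ 2 = 0 := by
      linear_combination D * hP
    linear_combination this - D * (N₁ + g * A) * hA + (N₁ + N₂) * (D * hA + g * A * hB)
      - (W.map C).prodForm (X ^ q) 1 X 1 * (D + g * B) * hB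
  obtain ⟨n, hn⟩ := exists_hasHeight (Or.inr hB0 : A ≠ 0 ∨ B ≠ 0)
  have hT : HasHeight q (X ^ q : F[X]) 1 := ⟨natDegree_X_pow_le q, by simp, Or.inl (by simp)⟩
  obtain ⟨A', B', l, hAB', -, -, h0, h1, h2⟩ :=
    W.exists_next hΔ isCoprime_one_right hAB hT hn htri
  rw [← hD] at h0
  have hAB1 : A * B' = N₁ := by
    apply mul_left_cancel₀ hg0
    apply mul_left_cancel₀ hB0
    linear_combination -g * A * h0 - D * hA + N₁ * hB
  have hAB2 : A' * B = N₂ := by linear_combination hS - h1 - hAB1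
  have hB'_ne : B' ≠ 0 := by rintro rfl; rw [mul_zero] at h0; exact hD0 h0
  have hmult : ∀ a : F, B.rootMultiplicity a = (Finset.univ.filter fun y : F ↦
      y ^ 2 + (W.a₁ * a + W.a₃) * y = a ^ 3 + W.a₂ * a ^ 2 + W.a₄ * a + W.a₆).card := by
    intro a
    have hh : h.eval a = W.a₁ * a + W.a₃ := by simp [h]
    have hf : f.eval a = a ^ 3 + W.a₂ * a ^ 2 + W.a₄ * a + W.a₆ := by simp [f]
    have hDa : D.eval a = 0 := by simp [hD, hpow]
    have hfq : (f ^ q).eval a = f.eval a := by simp [hpow]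
    have hhq : (h ^ q).eval a = h.eval a := by simp [hpow]
    have hDmult : D.rootMultiplicity a = 2 := by
      rw [hD, mul_one, one_mul, pow_two, rootMultiplicity_mul (by simpa [hD, pow_two] using hD0),
        ← count_roots, ← hq, FiniteField.roots_X_pow_card_sub_X]
      simp
    have hBB : B.rootMultiplicity a + B'.rootMultiplicity a = 2 := by
      rw [← rootMultiplicity_mul (mul_ne_zero hB0 hB'_ne), ← h0, hDmult]
    have e0 : B.eval a * B'.eval a = 0 := by rw [← eval_mul, ← h0, hDa]
    have e1 : A.eval a * B'.eval a = -U.eval a * h.eval a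
        + V.eval a * (h.eval a ^ 2 + 2 * f.eval a) + 2 * f.eval a := by
      rw [← eval_mul, hAB1, hN₁]
      simp only [eval_add, eval_sub, eval_mul, eval_neg, hfq, hDa]
      simp
      ring
    have e2 : A'.eval a * B.eval a = -U.eval a * h.eval a
        - 2 * V.eval a * f.eval a + 2 * f.eval a := by
      rw [← eval_mul, hAB2, hN₂]
      simp only [eval_add, eval_sub, eval_mul, eval_neg, hfq, hDa]
      simp
      ring
    have htra := congrArg (eval a) htr
    rw [eval_add, hhq] at htra
    have htra' : 2 * U.eval a + h.eval a = V.eval a * h.eval a := by simpa using htra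
    have hFroot : ∀ z : F, z ^ 2 + h.eval a * z = f.eval a → z = U.eval a + V.eval a * z := by
      intro z hz
      simpa [FiniteField.pow_card] using hroot F a z (by simpa using hz)
    have tri := card_quadratic_roots_trichotomy htra' hFroot (hroot (AlgebraicClosure F) a)
    rw [← hh, ← hf]
    have cop : ∀ {P Q : F[X]}, IsCoprime P Q → P.eval a = 0 → Q.eval a = 0 → False := by
      rintro P Q ⟨u, v, huv⟩ hP hQ
      simpa [hP, hQ] using congrArg (eval a) huv
    have zero : ∀ {P : F[X]}, P.eval a ≠ 0 → P.rootMultiplicity a = 0 := fun hP ↦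
      rootMultiplicity_eq_zero hP
    rcases tri with ⟨hm, hr⟩ | ⟨hm, hr, hr'⟩ | ⟨hm, hr'⟩
    · rw [hm]
      have := zero (right_ne_zero_of_mul (e1.trans_ne hr))
      omega
    · rw [hm]
      rw [hr] at e1
      rw [hr'] at e2
      have k1 : B.eval a = 0 := by
        by_contra hB1
        exact cop hAB' ((mul_eq_zero.mp e2).resolve_right hB1) ((mul_eq_zero.mp e0).resolve_left hB1)
      have k2 : B'.eval a = 0 := by
        by_contra hB1
        exact cop hAB ((mul_eq_zero.mp e1).resolve_right hB1) k1
      have := (rootMultiplicity_pos hB0).mpr k1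
      have := (rootMultiplicity_pos hB'_ne).mpr k2
      omega
    · rw [hm]
      exact zero (right_ne_zero_of_mul (e2.trans_ne hr'))
  have hdegB : B.natDegree = Nat.card {p : F × F |
        p.2 ^ 2 + W.a₁ * p.1 * p.2 + W.a₃ * p.2
          = p.1 ^ 3 + W.a₂ * p.1 ^ 2 + W.a₄ * p.1 + W.a₆} := by
    rw [W.card_points_eq_sum, ← Finset.sum_congr rfl fun a _ ↦ hmult a]
    refine (Splits.sum_rootMultiplicity (Splits.of_dvd ?_ hD0 ⟨B', h0⟩)).symm
    rw [hD, mul_one, one_mul, ← hq]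
    exact FiniteField.splits_X_pow_card_sub_X_self.pow 2
  have hdegA := W.natDegree_eq_succ_of_forms hq1 h0 h1 h2
  refine ⟨A, B, hAB, htri, ?_⟩
  rw [← hdegB, ← hdegA]
  refine ⟨le_rfl, by omega, Or.inl ?_⟩
  rw [coeff_natDegree, Ne, leadingCoeff_eq_zero]
  rintro rfl
  simp at hdegA

end WeierstrassCurve

/-- **Hasse's bound.** For an elliptic curve in Weierstrass form over a finite field with
`q` elements, the number `N` of points (affine solutions plus the point at infinity)
satisfies `(N − q − 1)² ≤ 4q`. -/
theorem stmt_3 (F : Type*) [Field F] [Fintype F]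
    (W : WeierstrassCurve F) (hΔ : W.Δ ≠ 0) (N : ℕ)
    (hN : N = Nat.card {p : F × F |
        p.2 ^ 2 + W.a₁ * p.1 * p.2 + W.a₃ * p.2
          = p.1 ^ 3 + W.a₂ * p.1 ^ 2 + W.a₄ * p.1 + W.a₆} + 1) :
    ((N : ℤ) - (Fintype.card F : ℤ) - 1) ^ 2 ≤ 4 * (Fintype.card F : ℤ) := by
  obtain ⟨A, B, hAB, htri, hN'⟩ := W.exists_hasHeight_card hΔ
  rw [← hN] at hN'
  set q := Fintype.card F
  have hT : HasHeight q (X ^ q : F[X]) 1 := ⟨natDegree_X_pow_le q, by simp, Or.inl (by simp)⟩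
  obtain ⟨A', B', l, hAB', hl, hlN, h0, h1, h2⟩ :=
    W.exists_next hΔ isCoprime_one_right hAB hT hN' htri
  have htri' : (W.map C).triForm (X ^ q) 1 X 1 A' B' = 0 := by
    rw [WeierstrassCurve.triForm, h0, h1, h2]; ring
  have key : ∀ {P Q : F[X]} {n : ℕ}, IsCoprime P Q → HasHeight n P Q →
      (W.map C).triForm (X ^ q) 1 X 1 P Q = 0 → (n : ℤ) - q - 1 ≤ 0 →
      ((n : ℤ) - q - 1) ^ 2 ≤ 4 * q := by
    intro P Q n hPQ hn hpq hle
    refine sq_le_four_mul_of_nonneg hle (fun i ↦ ?_) (fun i ↦ ?_)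
    · obtain ⟨_, _, _, _, u, v, -, -, -, -, -, hu, -⟩ :=
        W.exists_height_seq hΔ isCoprime_one_right hPQ hT hn hpq i
      rw [← hu]
      exact Int.natCast_nonneg u
    · obtain ⟨_, _, _, _, u, v, -, -, h3, h4, h5, hu, hv⟩ :=
        W.exists_height_seq hΔ isCoprime_one_right hPQ hT hn hpq i
      rw [← hu, ← hv]
      exact_mod_cast W.height_add_pos hΔ h3 h4 h5
  have hlN' : (l : ℤ) - q - 1 = -((N : ℤ) - q - 1) := by
    have : (l : ℤ) + N = 2 * q + 2 := by exact_mod_cast hlN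
    linear_combination this
  rcases le_total ((N : ℤ) - q - 1) 0 with h | h
  · exact key hAB hN' htri h
  · have := key hAB' hl htri' (by omega)
    rwa [hlN', neg_sq] at this
end

section
/- Let 𝔽_q be a finite field of odd characteristic with q ≥ 5 elements, and let G₄ be a ternary form of degree 4 over 𝔽_q such that over an algebraic closure of 𝔽_q the three partial derivatives ∂G₄/∂x, ∂G₄/∂y, ∂G₄/∂z have no common zero (x,y,z) ≠ (0,0,0). Then the number of (1,1,1,2)-equivalence classes of solutions (x,y,z,w) ∈ 𝔽_q⁴ ∖ {0} of the equation w² + G₄(x,y,z) = 0 is at least q + 1. -/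
open MvPolynomial

namespace Polynomial

theorem pow_half_of_not_isSquare {F : Type*} [Field F] [Fintype F] (hF : ringChar F ≠ 2) {a : F}
    (ha : ¬ IsSquare a) : a ^ (Fintype.card F / 2) = -1 := by
  have h0 : a ≠ 0 := by rintro rfl; exact ha IsSquare.zero
  exact (FiniteField.pow_dichotomy hF h0).resolve_left
    fun h => ha ((FiniteField.isSquare_iff hF h0).2 h)

theorem isSquare_mul_of_not_isSquare {F : Type*} [Field F] [Fintype F] (hF : ringChar F ≠ 2)
    {a b : F} (ha : ¬ IsSquare a) (hb : ¬ IsSquare b) : IsSquare (a * b) := by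
  have ha0 : a ≠ 0 := by rintro rfl; exact ha IsSquare.zero
  have hb0 : b ≠ 0 := by rintro rfl; exact hb IsSquare.zero
  rw [FiniteField.isSquare_iff hF (mul_ne_zero ha0 hb0), mul_pow,
    pow_half_of_not_isSquare hF ha, pow_half_of_not_isSquare hF hb]
  ring

theorem X_pow_card_sub_X_dvd {F : Type*} [Field F] [Fintype F] {p : F[X]}
    (h : ∀ t, p.eval t = 0) : (X ^ Fintype.card F - X : F[X]) ∣ p := by
  have hdeg := FiniteField.X_pow_card_sub_X_natDegree_eq F (Fintype.one_lt_card (α := F))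
  have hm : (X ^ Fintype.card F - X : F[X]).Monic :=
    monic_X_pow_sub (by rw [degree_X]; exact_mod_cast Fintype.one_lt_card (α := F))
  rw [← modByMonic_eq_zero_iff_dvd hm]
  refine eq_zero_of_natDegree_lt_card_of_eval_eq_zero' _ Finset.univ (fun t _ => ?_) ?_
  · have := congrArg (eval t) (modByMonic_add_div p (X ^ Fintype.card F - X : F[X]))
    simpa [h, FiniteField.pow_card] using this
  · rw [Finset.card_univ]
    refine (natDegree_modByMonic_lt p hm fun h1 => ?_).trans_eq hdeg
    rw [h1, natDegree_one] at hdeg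
    exact Fintype.card_ne_zero hdeg.symm

/-- A cubic polynomial over a finite field of odd order at least five takes a square value. -/
theorem exists_isSquare_eval_of_natDegree_eq_three {F : Type*} [Field F] [Fintype F]
    (hF : ringChar F ≠ 2) (hq : 5 ≤ Fintype.card F) {f : F[X]} (hf : f.natDegree = 3) :
    ∃ t, IsSquare (f.eval t) := by
  by_contra! hns
  have hodd := FiniteField.odd_card_of_char_ne_two hF
  set q := Fintype.card F with hqdef
  obtain ⟨n, hn⟩ : ∃ n, q = 2 * n + 1 := ⟨q / 2, by omega⟩
  have hn2 : q / 2 = n := by omega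
  obtain ⟨h, hh⟩ := X_pow_card_sub_X_dvd (p := f ^ n + 1) fun t => by
    have := pow_half_of_not_isSquare hF (hns t)
    rw [← hqdef, hn2] at this
    simp [this]
  rw [← hqdef] at hh
  have hf0 : f ≠ 0 := by rintro rfl; simp at hf
  have hdeg : (f ^ n + 1).natDegree = 3 * n := by
    have h1 : (f ^ n).natDegree = 3 * n := by rw [natDegree_pow, hf, mul_comm]
    rw [natDegree_add_eq_left_of_natDegree_lt, h1]
    rw [h1, natDegree_one]; omega
  have hXdeg : (X ^ q - X : F[X]).natDegree = q :=
    FiniteField.X_pow_card_sub_X_natDegree_eq F (by omega)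
  have hh0 : h ≠ 0 := by
    rintro rfl
    rw [hh, mul_zero, natDegree_zero] at hdeg
    omega
  have hX0 : (X ^ q - X : F[X]) ≠ 0 := by
    intro h0
    rw [h0, natDegree_zero] at hXdeg
    omega
  have hhdeg : h.natDegree = n - 1 := by
    rw [hh, natDegree_mul hX0 hh0, hXdeg] at hdeg
    omega
  have hder : C (n : F) * f ^ (n - 1) * derivative f =
      -h + (X ^ q - X) * derivative h := by
    have := congrArg derivative hh
    have hqc : (q : F) = 0 := by rw [hqdef]; exact Nat.cast_card_eq_zero F
    simpa [derivative_pow, hqc] using this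
  have hpow : f * f ^ (n - 1) = f ^ n := by
    rw [← pow_succ']; congr 1; omega
  have key : f * h - C (n : F) * derivative f =
      (X ^ q - X) * (f * derivative h - C (n : F) * derivative f * h) := by
    linear_combination f * hder - C (n : F) * derivative f * hh -
      C (n : F) * derivative f * hpow
  have hfh : (f * h).natDegree = n + 2 := by
    rw [natDegree_mul hf0 hh0, hf, hhdeg]; omega
  have hd : (C (n : F) * derivative f).natDegree ≤ 2 :=
    (natDegree_C_mul_le _ _).trans ((natDegree_derivative_le f).trans (by omega))
  have hl : (f * h - C (n : F) * derivative f).natDegree = n + 2 := by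
    rw [natDegree_sub_eq_left_of_natDegree_lt, hfh]
    omega
  have hr0 : f * derivative h - C (n : F) * derivative f * h ≠ 0 := by
    intro h0
    rw [key, h0, mul_zero, natDegree_zero] at hl
    omega
  rw [key, natDegree_mul hX0 hr0, hXdeg] at hl
  omega

/-- Over a finite field of odd order at least seven, a quadratic `u² + a u + b` with `b ≠ 0`
cannot have quadratic character opposite to that of `u` at all `u`. -/
theorem exists_pow_half_add_ne_zero {F : Type*} [Field F] [Fintype F]
    (hF : ringChar F ≠ 2) (hq : 7 ≤ Fintype.card F) (a : F) {b : F} (hb : ¬ IsSquare b) :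
    ∃ u : F, u ≠ 0 ∧
      (u ^ 2 + a * u + b) ^ (Fintype.card F / 2) + u ^ (Fintype.card F / 2) ≠ 0 := by
  by_contra! hu
  have hb0 : b ≠ 0 := by rintro rfl; exact hb IsSquare.zero
  have hbn := pow_half_of_not_isSquare hF hb
  have hodd := FiniteField.odd_card_of_char_ne_two hF
  have hqc : (Fintype.card F : F) = 0 := Nat.cast_card_eq_zero F
  have hpc := fun u : F => FiniteField.pow_card_sub_one_eq_one u
  have hcard : (Finset.univ : Finset F).card = Fintype.card F := Finset.card_univ
  generalize Fintype.card F = q at *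
  obtain ⟨n, hn⟩ : ∃ n, q = 2 * n + 1 := ⟨q / 2, by omega⟩
  have hn2 : q / 2 = n := by omega
  have hq1 : q - 1 = 2 * n := by omega
  rw [hn2] at hbn hu
  rw [hq1] at hpc
  have h2n : (2 : F) * n = -1 := by
    rw [hn] at hqc; push_cast at hqc; linear_combination hqc
  have hn0 : (n : F) ≠ 0 := by
    intro h; rw [h] at h2n; simp at h2n
  set Q : F[X] := X ^ 2 + C a * X + C b with hQ
  have hQd : Q.natDegree ≤ 2 := by rw [hQ]; compute_degree
  have hzero : Q ^ n + X ^ n - X ^ (2 * n) + 1 = 0 := by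
    refine eq_zero_of_natDegree_lt_card_of_eval_eq_zero' _ Finset.univ (fun t _ => ?_) ?_
    · rcases eq_or_ne t 0 with rfl | ht
      · have : n ≠ 0 := by omega
        simp [hQ, hbn, this]
      · have := hu t ht
        simp only [hQ, eval_add, eval_sub, eval_pow, eval_mul, eval_X, eval_C, eval_one,
          hpc t ht]
        linear_combination this
    · rw [hcard]
      have : n * Q.natDegree ≤ 2 * n := by nlinarith
      have : (Q ^ n + X ^ n - X ^ (2 * n) + 1).natDegree ≤ 2 * n := by
        compute_degree
        simp only [max_le_iff]
        omega
      omega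
  have hder : C (n : F) * Q ^ (n - 1) * derivative Q =
      X ^ (n - 1) * (C (2 * n : F) * X ^ n - C (n : F)) := by
    have := congrArg derivative hzero
    have h1 : 2 * n - 1 = (n - 1) + n := by omega
    simp only [derivative_add, derivative_sub, derivative_pow, derivative_X, derivative_one,
      derivative_zero, h1, pow_add] at this
    push_cast at this
    linear_combination this
  have hcop : IsCoprime (X ^ (n - 1) : F[X]) (Q ^ (n - 1)) := by
    refine IsCoprime.pow ⟨-C b⁻¹ * (X + C a), C b⁻¹, ?_⟩
    have : (C b⁻¹ * C b : F[X]) = 1 := by rw [← C_mul, inv_mul_cancel₀ hb0, C_1]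
    rw [hQ]
    linear_combination this
  have hdvd : (X ^ (n - 1) : F[X]) ∣ derivative Q := by
    have h1 : (X ^ (n - 1) : F[X]) ∣ Q ^ (n - 1) * (C (n : F) * derivative Q) :=
      ⟨_, by rw [← hder]; ring⟩
    have h2 := hcop.dvd_of_dvd_mul_left h1
    rwa [dvd_C_mul hn0] at h2
  have h2' : (2 : F) ≠ 0 := by
    intro h; rw [h] at h2n; simp at h2n
  have hQ' : derivative Q = C 2 * X + C a := by
    rw [hQ]; simp [derivative_pow]
  have hd1 : (derivative Q).natDegree = 1 := by
    rw [hQ', natDegree_linear h2']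
  have := natDegree_le_of_dvd hdvd (by intro h; rw [h, natDegree_zero] at hd1; omega)
  rw [natDegree_X_pow, hd1] at this
  omega

theorem exists_isSquare_biquadratic {F : Type*} [Field F] [Fintype F]
    (hF : ringChar F ≠ 2) (hq : 7 ≤ Fintype.card F) (a b : F) :
    ∃ t : F, IsSquare (t ^ 4 + a * t ^ 2 + b) := by
  by_contra! hns
  have hb : ¬ IsSquare b := by simpa using hns 0
  have hb0 : b ≠ 0 := by rintro rfl; exact hb IsSquare.zero
  have hsq : ∀ u : F, IsSquare u → ¬ IsSquare (u ^ 2 + a * u + b) := by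
    rintro u ⟨t, rfl⟩
    convert hns t using 2
    ring
  obtain ⟨u, hu0, hu⟩ := exists_pow_half_add_ne_zero hF hq a hb
  by_cases h : IsSquare u
  · rw [pow_half_of_not_isSquare hF (hsq u h), (FiniteField.isSquare_iff hF hu0).1 h] at hu
    simp at hu
  · have h1 : IsSquare (b / u) := by
      have := isSquare_mul_of_not_isSquare hF hb h
      have h2 : b / u = b * u / (u * u) := by field_simp
      rw [h2]
      exact this.div (IsSquare.mul_self u)
    have h3 := isSquare_mul_of_not_isSquare hF hb (hsq _ h1)
    have h4 : u ^ 2 + a * u + b = b * ((b / u) ^ 2 + a * (b / u) + b) * ((u / b) * (u / b)) := by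
      field_simp
      ring
    have h5 : IsSquare (u ^ 2 + a * u + b) := by
      rw [h4]; exact h3.mul (IsSquare.mul_self _)
    have h6 : u ^ 2 + a * u + b ≠ 0 := by
      rw [h4]
      refine mul_ne_zero (mul_ne_zero hb0 fun h0 => hsq _ h1 (h0 ▸ IsSquare.zero)) ?_
      exact mul_self_ne_zero.2 (div_ne_zero hu0 hb0)
    rw [(FiniteField.isSquare_iff hF h6).1 h5, pow_half_of_not_isSquare hF h] at hu
    simp at hu

/-- A monic quartic over a finite field of odd order at least seven takes a square value. -/
theorem exists_isSquare_monic_quartic {F : Type*} [Field F] [Fintype F]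
    (hF : ringChar F ≠ 2) (hq : 7 ≤ Fintype.card F) (a b c d : F) :
    ∃ t : F, IsSquare (t ^ 4 + a * t ^ 3 + b * t ^ 2 + c * t + d) := by
  have h2 : (2 : F) ≠ 0 := Ring.two_ne_zero hF
  obtain ⟨e, he⟩ : ∃ e : F, a = 4 * e :=
    ⟨a / (2 * 2), by rw [show (4 : F) = 2 * 2 by norm_num]; field_simp⟩
  obtain ⟨r, hr⟩ : ∃ r : F, b = 2 * r + 6 * e ^ 2 :=
    ⟨(b - 6 * e ^ 2) / 2, by field_simp; ring⟩
  -- After the shift `t ↦ t - e` the quartic is `(t ^ 2 + r) ^ 2 + m * t + k`.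
  obtain ⟨m, hm⟩ : ∃ m : F, c = m + 4 * r * e + 4 * e ^ 3 := ⟨c - 4 * r * e - 4 * e ^ 3, by ring⟩
  obtain ⟨k, hk⟩ : ∃ k : F, d = k + m * e + (e ^ 2 + r) ^ 2 :=
    ⟨d - m * e - (e ^ 2 + r) ^ 2, by ring⟩
  have hshift : ∀ s : F, (s - e) ^ 4 + a * (s - e) ^ 3 + b * (s - e) ^ 2 + c * (s - e) + d =
      (s ^ 2 + r) ^ 2 + m * s + k := by
    intro s
    rw [hk, hm, hr, he]
    ring
  by_cases hm0 : m = 0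
  · obtain ⟨s, hs⟩ := exists_isSquare_biquadratic hF hq (2 * r) (r ^ 2 + k)
    refine ⟨s - e, ?_⟩
    rw [hshift, hm0]
    convert hs using 1
    ring
  · refine ⟨-k / m - e, ?_⟩
    rw [hshift]
    have : m * (-k / m) = -k := by field_simp
    exact ⟨(-k / m) ^ 2 + r, by linear_combination this⟩

end Polynomial

namespace MvPolynomial

theorem derivative_aeval {R σ : Type*} [CommRing R] [Fintype σ] (a : σ → Polynomial R)
    (p : MvPolynomial σ R) :
    Polynomial.derivative (aeval a p) =
      ∑ i, aeval a (pderiv i p) * Polynomial.derivative (a i) := by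
  classical
  induction p using MvPolynomial.induction_on with
  | C r => simp [algHom_C]
  | add p q hp hq => simp [hp, hq, add_mul, Finset.sum_add_distrib]
  | mul_X p j hp =>
    have h : ∀ i, aeval a (pderiv i (p * X j)) * Polynomial.derivative (a i) =
        aeval a (pderiv i p) * Polynomial.derivative (a i) * a j +
          if j = i then aeval a p * Polynomial.derivative (a j) else 0 := by
      intro i
      rw [pderiv_mul, map_add, map_mul, map_mul, aeval_X]
      split_ifs with hij
      · subst hij
        rw [pderiv_X_self, map_one]
        ring
      · rw [pderiv_X_of_ne hij, map_zero]
        ring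
    rw [Finset.sum_congr rfl fun i _ => h i, Finset.sum_add_distrib, Finset.sum_ite_eq,
      if_pos (Finset.mem_univ j), ← Finset.sum_mul, ← hp, map_mul, aeval_X,
      Polynomial.derivative_mul]

theorem IsHomogeneous.aeval_mul {R A σ : Type*} [CommSemiring R] [CommSemiring A] [Algebra R A]
    {n : ℕ} {p : MvPolynomial σ R} (hp : p.IsHomogeneous n) (c : A) (a : σ → A) :
    MvPolynomial.aeval (fun i => c * a i) p = c ^ n * MvPolynomial.aeval a p := by
  rw [aeval_def, aeval_def, eval₂_eq, eval₂_eq, Finset.mul_sum]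
  refine Finset.sum_congr rfl fun d hd => ?_
  have hdeg : ∑ i ∈ d.support, d i = n := by
    have := hp (mem_support_iff.1 hd)
    rwa [Finsupp.weight_apply, Finsupp.sum, Finset.sum_congr rfl fun i _ => by
      rw [Pi.one_apply, smul_eq_mul, mul_one]] at this
  simp only [mul_pow, Finset.prod_mul_distrib, Finset.prod_pow_eq_pow_sum, hdeg]
  ring

theorem IsHomogeneous.reflect_aeval {F σ : Type*} [Field F] {n : ℕ} {G : MvPolynomial σ F}
    (hG : G.IsHomogeneous n) (P v : σ → F) :
    Polynomial.reflect n
        (MvPolynomial.aeval (fun i => Polynomial.C (P i) + Polynomial.C (v i) * Polynomial.X) G) =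
      MvPolynomial.aeval (fun i => Polynomial.C (P i) * Polynomial.X + Polynomial.C (v i)) G := by
  set f : Polynomial F :=
    MvPolynomial.aeval (fun i => Polynomial.C (P i) + Polynomial.C (v i) * Polynomial.X) G with hf
  have hdeg : f.natDegree ≤ n := by
    refine (aeval_natDegree_le G hG.totalDegree_le _ (n := 1) fun i => ?_).trans_eq (mul_one n)
    compute_degree
  have hX : (RatFunc.X : RatFunc F) ≠ 0 := RatFunc.X_ne_zero
  have hinj := RatFunc.algebraMap_injective F
  have haeval : ∀ p : Polynomial F,
      Polynomial.aeval (RatFunc.X : RatFunc F) p = algebraMap (Polynomial F) (RatFunc F) p := by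
    intro p
    rw [← RatFunc.algebraMap_X, Polynomial.aeval_algebraMap_apply, Polynomial.aeval_X_left_apply]
  apply hinj
  let _ : Invertible (RatFunc.X : RatFunc F)⁻¹ :=
    ⟨RatFunc.X, mul_inv_cancel₀ hX, inv_mul_cancel₀ hX⟩
  have h1 : Polynomial.aeval (RatFunc.X : RatFunc F) (Polynomial.reflect n f) *
      (RatFunc.X : RatFunc F)⁻¹ ^ n = Polynomial.aeval (RatFunc.X : RatFunc F)⁻¹ f :=
    Polynomial.eval₂_reflect_mul_pow (algebraMap F (RatFunc F)) (RatFunc.X : RatFunc F)⁻¹ n f hdeg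
  have h2 : Polynomial.aeval (RatFunc.X : RatFunc F)
      (MvPolynomial.aeval (fun i => Polynomial.C (P i) * Polynomial.X + Polynomial.C (v i)) G) =
      RatFunc.X ^ n * Polynomial.aeval (RatFunc.X : RatFunc F)⁻¹ f := by
    rw [hf, ← AlgHom.comp_apply, comp_aeval, ← AlgHom.comp_apply, comp_aeval, ← hG.aeval_mul]
    congr 2
    funext i
    simp only [map_add, map_mul, Polynomial.aeval_C, Polynomial.aeval_X]
    field_simp
  rw [← haeval, ← haeval, h2, ← h1, mul_comm, mul_assoc, inv_pow,
    inv_mul_cancel₀ (pow_ne_zero n hX), mul_one]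

theorem eval_aeval {F σ : Type*} [CommRing F] (a : σ → Polynomial F) (t : F)
    (p : MvPolynomial σ F) :
    (MvPolynomial.aeval a p).eval t = MvPolynomial.eval (fun i => (a i).eval t) p := by
  have := comp_aeval_apply (f := a) (Polynomial.aeval t) p
  simpa [Polynomial.coe_aeval_eq_eval, MvPolynomial.aeval_eq_eval] using this

/-- The restriction of a quartic form to the line through `P` and `v`. -/
theorem IsHomogeneous.exists_eval_line {F σ : Type*} [Field F] [Fintype σ]
    {G : MvPolynomial σ F} (hG : G.IsHomogeneous 4) (P v : σ → F) :
    ∃ a b c : F, ∀ t : F, MvPolynomial.eval (fun i => P i * t + v i) G =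
      MvPolynomial.eval P G * t ^ 4 + (∑ i, MvPolynomial.eval P (pderiv i G) * v i) * t ^ 3 +
        a * t ^ 2 + b * t + c := by
  have hrefl := hG.reflect_aeval P v
  set f : Polynomial F :=
    MvPolynomial.aeval (fun i => Polynomial.C (P i) + Polynomial.C (v i) * Polynomial.X) G with hf
  set g : Polynomial F :=
    MvPolynomial.aeval (fun i => Polynomial.C (P i) * Polynomial.X + Polynomial.C (v i)) G with hg
  have hdeg : g.natDegree < 5 := by
    refine Nat.lt_succ_of_le
      (aeval_natDegree_le G hG.totalDegree_le _ (n := 1) fun i => ?_)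
    compute_degree
  have h4 : g.coeff 4 = MvPolynomial.eval P G := by
    rw [← hrefl, Polynomial.coeff_reflect, Polynomial.revAt_le le_rfl,
      Polynomial.coeff_zero_eq_eval_zero, hf, eval_aeval]
    simp
  have h3 : g.coeff 3 = ∑ i, MvPolynomial.eval P (pderiv i G) * v i := by
    rw [← hrefl, Polynomial.coeff_reflect, Polynomial.revAt_le (by norm_num)]
    have : (Polynomial.derivative f).coeff 0 = f.coeff 1 := by
      simp [Polynomial.coeff_derivative]
    rw [show 4 - 3 = 1 from rfl, ← this, Polynomial.coeff_zero_eq_eval_zero, hf,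
      derivative_aeval, Polynomial.eval_finsetSum]
    simp [eval_aeval]
  refine ⟨g.coeff 2, g.coeff 1, g.coeff 0, fun t => ?_⟩
  have := eval_aeval (fun i => Polynomial.C (P i) * Polynomial.X + Polynomial.C (v i)) t G
  simp only [Polynomial.eval_add, Polynomial.eval_mul, Polynomial.eval_C,
    Polynomial.eval_X] at this
  rw [← this, ← hg, Polynomial.eval_eq_sum_range' hdeg, ← h4, ← h3]
  simp only [Finset.sum_range_succ, Finset.sum_range_zero]
  ring

end MvPolynomial

/-- Nonzero solutions of `w² + G(x, y, z) = 0`. -/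
abbrev DoublePlaneSol {F : Type*} [Field F] (G : MvPolynomial (Fin 3) F) : Type _ :=
  {v : F × F × F × F // v ≠ 0 ∧ v.2.2.2 ^ 2 + eval ![v.1, v.2.1, v.2.2.1] G = 0}

namespace DoublePlaneSol

variable {F : Type*} [Field F] {G : MvPolynomial (Fin 3) F}

/-- `(1,1,1,2)`-equivalence of solutions. -/
def Rel (p q : DoublePlaneSol G) : Prop :=
  ∃ l : F, l ≠ 0 ∧ q.1 = (l * p.1.1, l * p.1.2.1, l * p.1.2.2.1, l ^ 2 * p.1.2.2.2)

theorem equivalence_rel : Equivalence (Rel (G := G)) where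
  refl p := ⟨1, one_ne_zero, by simp⟩
  symm := by
    rintro p q ⟨l, hl, h⟩
    refine ⟨l⁻¹, inv_ne_zero hl, ?_⟩
    rw [h]
    simp [hl]
  trans := by
    rintro p q r ⟨l, hl, h⟩ ⟨m, hm, h'⟩
    refine ⟨m * l, mul_ne_zero hm hl, ?_⟩
    rw [h', h]
    simp only [mul_assoc, mul_pow]

theorem quot_mk_eq_iff {p q : DoublePlaneSol G} :
    Quot.mk Rel p = Quot.mk Rel q ↔ Rel p q :=
  ⟨fun h => equivalence_rel.eqvGen_iff.1 (Quot.eqvGen_exact h), fun h => Quot.sound h⟩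

theorem eval_smul (hG : G.IsHomogeneous 4) (l : F) (x : Fin 3 → F) :
    eval (fun i => l * x i) G = l ^ 4 * eval x G := by
  simpa [MvPolynomial.aeval_eq_eval] using hG.aeval_mul l x

theorem eval_smul_vec (hG : G.IsHomogeneous 4) (l a b c : F) :
    eval ![l * a, l * b, l * c] G = l ^ 4 * eval ![a, b, c] G := by
  rw [← eval_smul hG]
  congr 2
  funext i
  fin_cases i <;> rfl

theorem eval_vec (x : Fin 3 → F) : eval ![x 0, x 1, x 2] G = eval x G := by
  congr 2
  funext i
  fin_cases i <;> rfl

/-- The rescaling of a solution by a unit. -/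
def scale (hG : G.IsHomogeneous 4) (l : Fˣ) (p : DoublePlaneSol G) : DoublePlaneSol G :=
  ⟨(l * p.1.1, l * p.1.2.1, l * p.1.2.2.1, l ^ 2 * p.1.2.2.2), by
    obtain ⟨⟨x, y, z, w⟩, h0, h⟩ := p
    refine ⟨fun h' => h0 ?_, ?_⟩
    · simpa using h'
    · simp only at h ⊢
      rw [eval_smul_vec hG]
      linear_combination (l : F) ^ 4 * h⟩

/-- The solution given by a nonzero vector `x` and a square root of `-G x`. -/
def ofVec (x : Fin 3 → F) (w : F) (hx : x ≠ 0) (h : w ^ 2 + eval x G = 0) : DoublePlaneSol G :=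
  ⟨(x 0, x 1, x 2, w), by
    refine ⟨fun h0 => hx ?_, by simpa [eval_vec] using h⟩
    simp only [Prod.mk_eq_zero] at h0
    funext i
    fin_cases i
    exacts [h0.1, h0.2.1, h0.2.2.1]⟩

theorem exists_of_mk_ofVec_eq {x y : Fin 3 → F} {w u : F} (hx : x ≠ 0) (hy : y ≠ 0)
    (h : w ^ 2 + eval x G = 0) (h' : u ^ 2 + eval y G = 0)
    (hr : Quot.mk Rel (ofVec x w hx h) = Quot.mk Rel (ofVec y u hy h')) :
    ∃ l : F, y = l • x ∧ u = l ^ 2 * w := by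
  obtain ⟨l, hl, hr⟩ := quot_mk_eq_iff.1 hr
  simp only [ofVec, Prod.mk.injEq] at hr
  refine ⟨l, ?_, hr.2.2.2⟩
  funext i
  fin_cases i
  exacts [hr.1, hr.2.1, hr.2.2.1]

theorem eval_zero_vec (hG : G.IsHomogeneous 4) : eval (0 : Fin 3 → F) G = 0 := by
  simpa [← Pi.zero_def] using eval_smul hG 0 (0 : Fin 3 → F)

theorem vec_ne_zero (hG : G.IsHomogeneous 4) (p : DoublePlaneSol G) :
    ![p.1.1, p.1.2.1, p.1.2.2.1] ≠ 0 := by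
  obtain ⟨⟨x, y, z, w⟩, h0, h⟩ := p
  intro hx
  simp only at h hx
  rw [hx, eval_zero_vec hG, add_zero] at h
  have h1 : x = 0 := congrFun hx 0
  have h2 : y = 0 := congrFun hx 1
  have h3 : z = 0 := congrFun hx 2
  have h4 : w = 0 := by simpa using h
  exact h0 (by rw [h1, h2, h3, h4]; rfl)

variable [Fintype F]

theorem card_eq_mul (hG : G.IsHomogeneous 4) :
    Nat.card (DoublePlaneSol G) = Nat.card (Quot (Rel (G := G))) * (Fintype.card F - 1) := by
  classical
  rw [← Fintype.card_units, ← Nat.card_eq_fintype_card (α := Fˣ), ← Nat.card_prod]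
  refine (Nat.card_eq_of_bijective
    (fun c : Quot (Rel (G := G)) × Fˣ => scale hG c.2 c.1.out) ⟨?_, ?_⟩).symm
  · rintro ⟨c, l⟩ ⟨d, m⟩ h
    have hrel : ∀ (k : Fˣ) (p : DoublePlaneSol G), Quot.mk Rel p = Quot.mk Rel (scale hG k p) :=
      fun k p => Quot.sound ⟨k, k.ne_zero, rfl⟩
    have hcd : c = d := by
      have := congrArg (Quot.mk Rel) h
      rwa [← hrel, ← hrel, Quot.out_eq, Quot.out_eq] at this
    subst hcd
    simp only [Prod.mk.injEq, true_and]
    have h' := congrArg Subtype.val h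
    simp only [scale, Prod.mk.injEq] at h'
    by_contra hlm
    have hlm' : (l : F) ≠ m := fun h0 => hlm (Units.ext h0)
    refine vec_ne_zero hG c.out (funext fun i => ?_)
    have hcancel : ∀ x : F, l * x = m * x → x = 0 := fun x hx =>
      (mul_eq_mul_right_iff.1 hx).resolve_left hlm'
    fin_cases i
    exacts [hcancel _ h'.1, hcancel _ h'.2.1, hcancel _ h'.2.2.1]
  · intro p
    obtain ⟨l, hl, h⟩ := quot_mk_eq_iff.1 (Quot.out_eq (Quot.mk Rel p))
    exact ⟨(Quot.mk Rel p, Units.mk0 l hl), Subtype.ext h.symm⟩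

theorem card_add_one (hF : ringChar F ≠ 2) (hG : G.IsHomogeneous 4) :
    (Nat.card (DoublePlaneSol G) : F) + 1 = 0 := by
  classical
  have hsum : ∑ x : Fin 3 → F, eval x ((-G) ^ (Fintype.card F / 2)) = 0 := by
    refine sum_eval_eq_zero _ ?_
    have h1 := totalDegree_pow (-G) (Fintype.card F / 2)
    rw [totalDegree_neg] at h1
    have h2 := Nat.mul_le_mul_left (Fintype.card F / 2) hG.totalDegree_le
    have h3 := FiniteField.odd_card_of_char_ne_two hF
    have h4 := Fintype.one_lt_card (α := F)
    rw [Fintype.card_fin]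
    omega
  have hfib : ∀ x : Fin 3 → F,
      (Nat.card {w : F // w ^ 2 + eval x G = 0} : F) =
        eval x ((-G) ^ (Fintype.card F / 2)) + 1 := by
    intro x
    have h1 := quadraticChar_card_sqrts hF (-eval x G)
    have h2 := quadraticChar_eq_pow_of_char_ne_two' hF (-eval x G)
    rw [map_pow, map_neg, ← h2]
    have h3 : Nat.card {w : F // w ^ 2 + eval x G = 0} =
        {w : F | w ^ 2 = -eval x G}.toFinset.card := by
      rw [Nat.card_eq_fintype_card, Set.toFinset_card]
      exact Fintype.card_congr (Equiv.subtypeEquivRight fun w => add_eq_zero_iff_eq_neg)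
    rw [h3]
    exact_mod_cast congrArg (Int.cast : ℤ → F) h1
  have hinj : Function.Injective
      (fun p : Σ x : Fin 3 → F, {w : F // w ^ 2 + eval x G = 0} => (p.1, (p.2 : F))) := by
    rintro ⟨x, w, h⟩ ⟨y, u, h'⟩ heq
    simp only [Prod.mk.injEq] at heq
    obtain ⟨rfl, rfl⟩ := heq
    rfl
  let e : Option (DoublePlaneSol G) → Σ x : Fin 3 → F, {w : F // w ^ 2 + eval x G = 0} :=
    fun o => o.elim ⟨0, 0, by rw [eval_zero_vec hG]; ring⟩
      fun p => ⟨![p.1.1, p.1.2.1, p.1.2.2.1], p.1.2.2.2, p.2.2⟩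
  have he : Function.Bijective e := by
    constructor
    · rintro (_ | p) (_ | q) h
      · rfl
      · exact (vec_ne_zero hG q (congrArg Sigma.fst h).symm).elim
      · exact (vec_ne_zero hG p (congrArg Sigma.fst h)).elim
      · have h1 := congrArg Sigma.fst h
        have h2 : p.1.2.2.2 = q.1.2.2.2 := congrArg (fun s => (s.2 : F)) h
        exact congrArg some (Subtype.ext (Prod.ext (congrFun h1 0)
          (Prod.ext (congrFun h1 1) (Prod.ext (congrFun h1 2) h2))))
    · rintro ⟨x, w, h⟩
      by_cases hx : x = 0
      · subst hx
        refine ⟨none, hinj (Prod.ext rfl ?_)⟩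
        rw [eval_zero_vec hG, add_zero] at h
        exact (pow_eq_zero_iff two_ne_zero).1 h |>.symm
      · refine ⟨some (ofVec x w hx h), hinj (Prod.ext (funext fun i => ?_) rfl)⟩
        fin_cases i <;> rfl
  have hcard : Nat.card (DoublePlaneSol G) + 1 =
      ∑ x : Fin 3 → F, Nat.card {w : F // w ^ 2 + eval x G = 0} := by
    rw [← Finite.card_option, Nat.card_eq_of_bijective e he, Nat.card_sigma]
  have := congrArg (Nat.cast : ℕ → F) hcard
  push_cast at this
  rw [this, Finset.sum_congr rfl fun x _ => hfib x, Finset.sum_add_distrib, hsum]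
  simp

/-- The number of rational points of the double plane is congruent to `1` modulo the
characteristic. -/
theorem card_quot (hF : ringChar F ≠ 2) (hG : G.IsHomogeneous 4) :
    (Nat.card (Quot (Rel (G := G))) : F) = 1 := by
  have h := card_add_one hF hG
  rw [card_eq_mul hG, Nat.cast_mul, Nat.cast_pred Fintype.card_pos, Nat.cast_card_eq_zero] at h
  linear_combination -h

theorem exists_sol (hF : ringChar F ≠ 2) (hG : G.IsHomogeneous 4) :
    ∃ (x : Fin 3 → F) (w : F), x ≠ 0 ∧ w ^ 2 + eval x G = 0 := by
  have h := card_quot hF hG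
  have : Nonempty (Quot (Rel (G := G))) := by
    by_contra h0
    rw [not_nonempty_iff] at h0
    simp at h
  let p := (Classical.choice this).out
  exact ⟨_, p.1.2.2.2, vec_ne_zero hG p, p.2.2⟩

/-- If a point of the double plane is given, and every line in a pencil through its image but
one carries a further point, then there are at least `q + 1` points. -/
theorem card_add_one_le_of_pencil {P : Fin 3 → F} {w : F} (hP : P ≠ 0) (hw : w ^ 2 + eval P G = 0)
    {ℓ : (Fin 3 → F) →ₗ[F] F} (hℓ : ℓ ≠ 0) (hℓP : ℓ P = 0)
    (h : ∀ v, ℓ v ≠ 0 → ∃ t u : F, u ^ 2 + eval (fun i => P i * t + v i) G = 0) :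
    Fintype.card F + 1 ≤ Nat.card (Quot (Rel (G := G))) := by
  obtain ⟨v₀, hv₀⟩ : ∃ v, ℓ v ≠ 0 := by
    by_contra! h0
    exact hℓ (LinearMap.ext h0)
  obtain ⟨v₁, hv₁, hv₁P⟩ : ∃ v ∈ LinearMap.ker ℓ, v ∉ Submodule.span F {P} := by
    by_contra! h0
    have h1 : Module.finrank F (LinearMap.ker ℓ) ≤ 1 :=
      (Submodule.finrank_mono h0).trans (finrank_span_singleton hP).le
    have h2 := LinearMap.finrank_range_add_finrank_ker ℓ
    have h3 := Submodule.finrank_le (LinearMap.range ℓ)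
    rw [Module.finrank_fin_fun] at h2
    rw [Module.finrank_self] at h3
    omega
  rw [LinearMap.mem_ker] at hv₁
  have hℓs : ∀ s t : F, ℓ (t • P + (v₀ + s • v₁)) = ℓ v₀ := by
    intro s t
    simp [hℓP, hv₁]
  choose! t u htu using fun s : F => h (v₀ + s • v₁) (by simpa [hv₁] using hv₀)
  have hne : ∀ s, t s • P + (v₀ + s • v₁) ≠ 0 := by
    intro s h0
    have := hℓs s (t s)
    rw [h0, map_zero] at this
    exact hv₀ this.symm
  have hsol : ∀ s, u s ^ 2 + eval (t s • P + (v₀ + s • v₁)) G = 0 := by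
    intro s
    rw [← htu s]
    congr 3
    funext i
    simp [mul_comm]
  let f : Option F → Quot (Rel (G := G)) := fun o =>
    Quot.mk Rel (o.elim (ofVec P w hP hw) fun s => ofVec _ _ (hne s) (hsol s))
  have hf : Function.Injective f := by
    have hnone : ∀ s, f none ≠ f (some s) := by
      intro s hs
      obtain ⟨l, hl, -⟩ := exists_of_mk_ofVec_eq hP (hne s) hw (hsol s) hs
      have := hℓs s (t s)
      rw [hl, map_smul, hℓP, smul_zero] at this
      exact hv₀ this.symm
    rintro (_ | r) (_ | s) hrs
    · rfl
    · exact (hnone s hrs).elim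
    · exact (hnone r hrs.symm).elim
    · obtain ⟨l, hl, -⟩ :=
        exists_of_mk_ofVec_eq (hne r) (hne s) (hsol r) (hsol s) hrs
      have h1 := hℓs s (t s)
      rw [hl, map_smul, hℓs, smul_eq_mul] at h1
      have hl1 : l = 1 := by
        rwa [mul_eq_right₀ hv₀] at h1
      rw [hl1, one_smul] at hl
      by_contra hrs'
      have hrs0 : s - r ≠ 0 := sub_ne_zero.2 fun h0 => hrs' (by rw [h0])
      refine hv₁P (Submodule.mem_span_singleton.2 ⟨(t r - t s) / (s - r), ?_⟩)
      have h2 : (s - r) • v₁ = (t r - t s) • P := by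
        funext i
        have := congrFun hl i
        simp only [Pi.add_apply, Pi.smul_apply, smul_eq_mul] at this ⊢
        linear_combination this
      rw [div_eq_inv_mul, mul_smul, ← h2, smul_smul, inv_mul_cancel₀ hrs0, one_smul]
  have := Nat.card_le_card_of_injective f hf
  rwa [Finite.card_option, Nat.card_eq_fintype_card] at this

end DoublePlaneSol

namespace DoublePlaneSol

variable {F : Type*} [Field F] {G : MvPolynomial (Fin 3) F}

/-- The polar of `G` at `P`, i.e. the differential of `G` at `P`. -/
noncomputable def polar (G : MvPolynomial (Fin 3) F) (P : Fin 3 → F) : (Fin 3 → F) →ₗ[F] F :=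
  ∑ i, eval P (pderiv i G) • LinearMap.proj i

theorem polar_apply (P v : Fin 3 → F) : polar G P v = ∑ i, eval P (pderiv i G) * v i := by
  simp [polar]

theorem polar_self (hG : G.IsHomogeneous 4) (P : Fin 3 → F) : polar G P P = 4 * eval P G := by
  have := congrArg (eval P) hG.sum_X_mul_pderiv
  simp only [map_sum, map_mul, eval_X, nsmul_eq_mul, Nat.cast_ofNat, map_ofNat] at this
  rw [polar_apply, ← this]
  exact Finset.sum_congr rfl fun i _ => mul_comm _ _

theorem polar_ne_zero
    (hsmooth : ∀ x y z : AlgebraicClosure F,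
      (∀ i : Fin 3,
        eval ![x, y, z]
          (MvPolynomial.map (algebraMap F (AlgebraicClosure F)) (pderiv i G)) = 0) →
      x = 0 ∧ y = 0 ∧ z = 0) {P : Fin 3 → F} (hP : P ≠ 0) : polar G P ≠ 0 := by
  intro h0
  have hd : ∀ i, eval P (pderiv i G) = 0 := by
    intro i
    have := LinearMap.congr_fun h0 (Pi.single i 1)
    simpa [polar_apply, Pi.single_apply] using this
  have hvec : ![algebraMap F (AlgebraicClosure F) (P 0), algebraMap F (AlgebraicClosure F) (P 1),
      algebraMap F (AlgebraicClosure F) (P 2)] = fun i => algebraMap F (AlgebraicClosure F) (P i) := by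
    funext i
    fin_cases i <;> rfl
  obtain ⟨h1, h2, h3⟩ := hsmooth _ _ _ fun i => by
    rw [hvec, eval_map, ← Function.comp_def, ← eval₂_comp, hd, map_zero]
  rw [FaithfulSMul.algebraMap_eq_zero_iff] at h1 h2 h3
  refine hP (funext fun i => ?_)
  fin_cases i
  exacts [h1, h2, h3]

theorem exists_ne_zero_apply_eq_zero (P : Fin 3 → F) :
    ∃ ℓ : (Fin 3 → F) →ₗ[F] F, ℓ ≠ 0 ∧ ℓ P = 0 := by
  have htop : Submodule.span F {P} < ⊤ := by
    refine lt_top_iff_ne_top.2 fun h => ?_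
    have h1 := finrank_span_le_card (R := F) ({P} : Set (Fin 3 → F))
    rw [h, finrank_top, Module.finrank_fin_fun] at h1
    simp at h1
  obtain ⟨ℓ, hℓ, hle⟩ := Submodule.exists_le_ker_of_lt_top _ htop
  exact ⟨ℓ, hℓ, hle (Submodule.mem_span_singleton_self P)⟩

variable [Fintype F]

theorem card_add_one_le_of_zero (hF : ringChar F ≠ 2) (hq : 5 ≤ Fintype.card F)
    (hG : G.IsHomogeneous 4) {P : Fin 3 → F} (hP : P ≠ 0) (hGP : eval P G = 0)
    (hpolar : polar G P ≠ 0) : Fintype.card F + 1 ≤ Nat.card (Quot (Rel (G := G))) := by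
  refine card_add_one_le_of_pencil (w := 0) hP (by simp [hGP]) hpolar
    (by rw [polar_self hG, hGP, mul_zero]) fun v hv => ?_
  obtain ⟨a, b, c, habc⟩ := hG.exists_eval_line P v
  rw [hGP, ← polar_apply] at habc
  obtain ⟨t, u, hu⟩ := Polynomial.exists_isSquare_eval_of_natDegree_eq_three hF hq
    (Polynomial.natDegree_cubic (b := -a) (c := -b) (d := -c) (neg_ne_zero.2 hv))
  refine ⟨t, u, ?_⟩
  simp only [Polynomial.eval_add, Polynomial.eval_mul, Polynomial.eval_C, Polynomial.eval_pow,
    Polynomial.eval_X] at hu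
  rw [habc]
  linear_combination -hu

theorem card_add_one_le_of_seven_le (hF : ringChar F ≠ 2) (hq : 7 ≤ Fintype.card F)
    (hG : G.IsHomogeneous 4) {P : Fin 3 → F} {w : F} (hP : P ≠ 0) (hw : w ≠ 0)
    (hPw : w ^ 2 + eval P G = 0) : Fintype.card F + 1 ≤ Nat.card (Quot (Rel (G := G))) := by
  obtain ⟨ℓ, hℓ, hℓP⟩ := exists_ne_zero_apply_eq_zero P
  refine card_add_one_le_of_pencil hP hPw hℓ hℓP fun v _ => ?_
  obtain ⟨a, b, c, habc⟩ := hG.exists_eval_line P v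
  obtain ⟨t, u, hu⟩ := Polynomial.exists_isSquare_monic_quartic hF hq
    (-(∑ i, eval P (pderiv i G) * v i) / w ^ 2) (-a / w ^ 2) (-b / w ^ 2) (-c / w ^ 2)
  refine ⟨t, w * u, ?_⟩
  rw [habc, eq_neg_of_add_eq_zero_right hPw]
  field_simp at hu
  linear_combination -hu

theorem card_add_one_le_of_card_eq_five (hF : ringChar F ≠ 2) (hq : Fintype.card F = 5)
    (hG : G.IsHomogeneous 4) {P : Fin 3 → F} {w : F} (hP : P ≠ 0) (hw : w ≠ 0)
    (hPw : w ^ 2 + eval P G = 0) : Fintype.card F + 1 ≤ Nat.card (Quot (Rel (G := G))) := by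
  have hchar : ringChar F = 5 := by
    have h5 : ((5 : ℕ) : F) = 0 := by rw [← hq, Nat.cast_card_eq_zero]
    exact ((Nat.dvd_prime Nat.prime_five).1 (ringChar.dvd h5)).resolve_left
      CharP.ringChar_ne_one
  have hcard := card_quot hF hG
  have hPw' : (-w) ^ 2 + eval P G = 0 := by rwa [neg_sq]
  have hne : Quot.mk Rel (ofVec P w hP hPw) ≠ Quot.mk Rel (ofVec P (-w) hP hPw') := by
    intro h
    obtain ⟨l, hl, hlw⟩ := exists_of_mk_ofVec_eq hP hP hPw hPw' h
    obtain ⟨i, hi⟩ := Function.ne_iff.1 hP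
    have hl1 : l = 1 := by
      have := congrFun hl i
      rwa [Pi.smul_apply, smul_eq_mul, eq_comm, mul_eq_right₀ hi] at this
    rw [hl1, one_pow, one_mul] at hlw
    exact hw ((Ring.eq_self_iff_eq_zero_of_char_ne_two hF).1 hlw)
  have : Nontrivial (Quot (Rel (G := G))) := ⟨_, _, hne⟩
  have hone := Finite.one_lt_card (α := Quot (Rel (G := G)))
  have hdvd : ringChar F ∣ Nat.card (Quot (Rel (G := G))) - 1 := by
    refine ringChar.dvd ?_
    rw [Nat.cast_sub hone.le, hcard, Nat.cast_one, sub_self]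
  rw [hchar] at hdvd
  omega

theorem card_add_one_le (hF : ringChar F ≠ 2) (hq : 5 ≤ Fintype.card F)
    (hG : G.IsHomogeneous 4) (hpolar : ∀ P : Fin 3 → F, P ≠ 0 → polar G P ≠ 0) :
    Fintype.card F + 1 ≤ Nat.card (Quot (Rel (G := G))) := by
  obtain ⟨P, w, hP, hPw⟩ := exists_sol hF hG
  by_cases hw : w = 0
  · refine card_add_one_le_of_zero hF hq hG hP ?_ (hpolar P hP)
    simpa [hw] using hPw
  · rcases le_or_gt 7 (Fintype.card F) with h7 | h7
    · exact card_add_one_le_of_seven_le hF h7 hG hP hw hPw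
    · have hodd := FiniteField.odd_card_of_char_ne_two hF
      exact card_add_one_le_of_card_eq_five hF (by omega) hG hP hw hPw

end DoublePlaneSol

/-- Let `𝔽_q` be a finite field of odd characteristic with `q ≥ 5` elements and `G₄` a
ternary quartic form over `𝔽_q` whose partial derivatives have no common nonzero zero
over an algebraic closure (i.e. the quartic curve `G₄ = 0` is smooth). Then the smooth
degree-2 del Pezzo surface `w² + G₄(x,y,z) = 0` in `ℙ(1,1,1,2)` has at least `q + 1`
rational points, i.e. the number of `(1,1,1,2)`-equivalence classes of nonzero solutions
in `𝔽_q⁴` is at least `q + 1`. -/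
theorem stmt_17 (F : Type*) [Field F] [Fintype F]
    (hchar : Odd (ringChar F)) (hq : 5 ≤ Fintype.card F)
    (G₄ : MvPolynomial (Fin 3) F) (hG₄ : G₄.IsHomogeneous 4)
    (hsmooth : ∀ x y z : AlgebraicClosure F,
      (∀ i : Fin 3,
        eval ![x, y, z]
          (MvPolynomial.map (algebraMap F (AlgebraicClosure F)) (pderiv i G₄)) = 0) →
      x = 0 ∧ y = 0 ∧ z = 0) :
    Fintype.card F + 1 ≤
      Nat.card (Quot (fun p q : {v : F × F × F × F // v ≠ 0 ∧
          v.2.2.2 ^ 2 + eval ![v.1, v.2.1, v.2.2.1] G₄ = 0} =>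
        ∃ l : F, l ≠ 0 ∧
          q.1 = (l * p.1.1, l * p.1.2.1, l * p.1.2.2.1, l ^ 2 * p.1.2.2.2))) := by
  have hF : ringChar F ≠ 2 := by
    intro h
    rw [h] at hchar
    exact absurd hchar (by decide)
  exact DoublePlaneSol.card_add_one_le hF hq hG₄ fun P hP =>
    DoublePlaneSol.polar_ne_zero hsmooth hP
end
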